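/- arXiv:1710.02308 — 2 statements merged into one kernel-verified Lean document; each statement's English description precedes it below -/
import Mathlib

section
/- Let a∈(0,∞)^Ṽ and b∈ℝ^Ṽ with a_δ=1 and b_δ=0. Then for every Borel measurable function f:Ω_V→[0,∞], ∫ f(u,s)·exp(−Σ_{i∈V}[(a_i²+b_i²−1)β_i(u)+b_iθ_i(u,s)]) dμ^W(u,s) = L^W(a,b)·∫ (f∘S_{[a,b]})(u,s) dμ^{W^a}(u,s), where μ^{W^a} is the measure μ associated with the rescaled weights W^a. Equivalently, the image of μ^{W^a} under S_{[a,b]} is absolutely continuous with respect to μ^W with Radon–Nikodym derivative L^W(a,b)^{−1}·exp(−Σ_{i∈V}[(a_i²+b_i²−1)β_i(u)+b_iθ_i(u,s)]). -/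
open MeasureTheory Real Finset BigOperators

noncomputable section

/-- The matrix `A^W(u)`: off-diagonal entries `-W i j * exp (u i + u j)`,
diagonal entries `∑ k, W i k * exp (u i + u k)`. -/
def Amat {V : Type*} [Fintype V] [DecidableEq V] (W : V → V → ℝ) (u : V → ℝ) :
    Matrix V V ℝ :=
  Matrix.of fun i j =>
    if i = j then ∑ k, W i k * Real.exp (u i + u k)
    else -(W i j * Real.exp (u i + u j))

/-- The restriction `A^W_{VV}(u)` of `A^W(u)` to `V×V` where `V = Ṽ∖{δ}`. -/
def AVV {V : Type*} [Fintype V] [DecidableEq V] (W : V → V → ℝ) (δ : V) (u : V → ℝ) :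
    Matrix {i : V // i ≠ δ} {i : V // i ≠ δ} ℝ :=
  Matrix.of fun i j => Amat W u i.1 j.1

/-- The density `ρ^W(u,s)`.  The product over undirected edges
`∏_{(i∼j)∈Ẽ} e^{−W_{ij}(cosh(u_i−u_j)−1)}` is written as
`exp(−(1/2)·Σ_{i,j} W_{ij}(cosh(u_i−u_j)−1))` (sum over all ordered pairs), which agrees
with it since `W` is symmetric and vanishes on the diagonal and off the edge set. -/
def rhoW {V : Type*} [Fintype V] [DecidableEq V] (W : V → V → ℝ) (δ : V) (u s : V → ℝ) :
    ℝ :=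
  Real.exp (-(1 / 2) * ∑ i, ∑ j, s i * Amat W u i j * s j)
    * (AVV W δ u).det
    * Real.exp (-((1 / 2) * ∑ i, ∑ j, W i j * (Real.cosh (u i - u j) - 1)))

/-- Extension of a vector indexed by `V = Ṽ∖{δ}` to `Ṽ` by the value `0` at `δ`. -/
def extendByZero {V : Type*} [DecidableEq V] (δ : V) (x : {i : V // i ≠ δ} → ℝ) : V → ℝ :=
  fun i => if h : i = δ then 0 else x ⟨i, h⟩

/-- The reference measure on `(ℝ^Ṽ)×(ℝ^Ṽ)`: Lebesgue measure on the coordinates in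
`V = Ṽ∖{δ}`, with the coordinates at `δ` fixed to `0` (Dirac measure at `0`). -/
def baseMeasure {V : Type*} [Fintype V] [DecidableEq V] (δ : V) :
    Measure ((V → ℝ) × (V → ℝ)) :=
  Measure.map
    (fun p : ({i : V // i ≠ δ} → ℝ) × ({i : V // i ≠ δ} → ℝ) =>
      (extendByZero δ p.1, extendByZero δ p.2))
    volume

/-- The measure `μ^W(du ds) = ρ^W(u,s)·∏_{i∈V}(2π)^{−1} e^{−u_i} du_i ds_i` on `Ω_V`. -/
def muW {V : Type*} [Fintype V] [DecidableEq V] (W : V → V → ℝ) (δ : V) :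
    Measure ((V → ℝ) × (V → ℝ)) :=
  (baseMeasure δ).withDensity fun p =>
    ENNReal.ofReal (rhoW W δ p.1 p.2 *
      ∏ i : {i : V // i ≠ δ}, Real.exp (-(p.1 i.1)) / (2 * Real.pi))

/-- `β_i(u) = (1/2)·Σ_j W_{ij} e^{u_j−u_i}`. -/
def betaW {V : Type*} [Fintype V] (W : V → V → ℝ) (u : V → ℝ) (i : V) : ℝ :=
  (1 / 2) * ∑ j, W i j * Real.exp (u j - u i)

/-- `θ_i(u,s) = Σ_j W_{ij} e^{u_j}(s_i−s_j)`. -/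
def thetaW {V : Type*} [Fintype V] (W : V → V → ℝ) (u s : V → ℝ) (i : V) : ℝ :=
  ∑ j, W i j * Real.exp (u j) * (s i - s j)

/-- The scaling transformation `S_{[a,b]}(u,s) = (u + log a, s − e^{−u} b / a)`,
componentwise. -/
def Smap {V : Type*} (a b : V → ℝ) (p : (V → ℝ) × (V → ℝ)) : (V → ℝ) × (V → ℝ) :=
  (fun i => p.1 i + Real.log (a i),
   fun i => p.2 i - Real.exp (-(p.1 i)) * b i / a i)

/-- The constant `L^W(a,b) = ∏_{(i∼j)∈Ẽ} e^{−W_{ij}(a_i a_j + b_i b_j − 1)}·∏_{j∈V} a_j⁻¹`,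
with the edge product written via a sum over ordered pairs. -/
def LW {V : Type*} [Fintype V] [DecidableEq V] (W : V → V → ℝ) (δ : V) (a b : V → ℝ) : ℝ :=
  Real.exp (-((1 / 2) * ∑ i, ∑ j, W i j * (a i * a j + b i * b j - 1)))
    * ∏ j : {i : V // i ≠ δ}, (a j.1)⁻¹

lemma Amat_quad {V : Type*} [Fintype V] [DecidableEq V] (W : V → V → ℝ)
    (hdiag : ∀ i, W i i = 0) (u s : V → ℝ) :
    ∑ i, ∑ j, s i * Amat W u i j * s j
      = ∑ i, ∑ j, W i j * Real.exp (u i + u j) * (s i ^ 2 - s i * s j) := by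
  refine Finset.sum_congr rfl fun i _ => ?_
  have h : ∀ j, s i * Amat W u i j * s j
      = (if i = j then s i ^ 2 * ∑ k, W i k * Real.exp (u i + u k) else 0)
        - W i j * Real.exp (u i + u j) * (s i * s j) := by
    intro j
    by_cases hij : i = j
    · subst hij
      simp [Amat, hdiag]
      ring
    · simp [Amat, hij]
      ring
  simp_rw [h]
  rw [Finset.sum_sub_distrib, Finset.sum_ite_eq]
  simp only [Finset.mem_univ, if_true]
  rw [Finset.mul_sum, ← Finset.sum_sub_distrib]
  refine Finset.sum_congr rfl fun j _ => ?_
  ring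

lemma sum_symm_eq {V : Type*} [Fintype V] (F G : V → V → ℝ)
    (h : ∀ i j, F i j + F j i = G i j + G j i) :
    ∑ i, ∑ j, F i j = ∑ i, ∑ j, G i j := by
  have hF : ∑ i, ∑ j, F j i = ∑ i, ∑ j, F i j := Finset.sum_comm
  have hG : ∑ i, ∑ j, G j i = ∑ i, ∑ j, G i j := Finset.sum_comm
  have h2 : ∑ i, ∑ j, (F i j + F j i) = ∑ i, ∑ j, (G i j + G j i) :=
    Finset.sum_congr rfl fun i _ => Finset.sum_congr rfl fun j _ => h i j
  simp only [Finset.sum_add_distrib] at h2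
  linarith

lemma Amat_scale {V : Type*} [Fintype V] [DecidableEq V] (W : V → V → ℝ)
    (a : V → ℝ) (ha : ∀ i, 0 < a i) (u : V → ℝ) :
    Amat W (fun i => u i + Real.log (a i)) = Amat (fun i j => a i * a j * W i j) u := by
  have h : ∀ i j, Real.exp (u i + Real.log (a i) + (u j + Real.log (a j)))
      = a i * a j * Real.exp (u i + u j) := by
    intro i j
    simp only [Real.exp_add, Real.exp_log (ha _)]
    ring
  ext i j
  by_cases hij : i = j
  · simp only [Amat, Matrix.of_apply, hij, if_true, h]
    refine Finset.sum_congr rfl fun k _ => ?_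
    ring
  · simp only [Amat, Matrix.of_apply, hij, if_false, h]
    ring

lemma sum_subtype_zero {V : Type*} [Fintype V] [DecidableEq V] (δ : V) (g : V → ℝ)
    (h : g δ = 0) : ∑ i : {i : V // i ≠ δ}, g i.1 = ∑ i, g i := by
  rw [← Finset.sum_erase Finset.univ h]
  exact (Finset.sum_subtype (Finset.univ.erase δ) (by simp) g).symm

lemma exponent_id {V : Type*} [Fintype V] [DecidableEq V] (W : V → V → ℝ) (δ : V)
    (hsymm : ∀ i j, W i j = W j i) (hdiag : ∀ i, W i i = 0)
    (a b : V → ℝ) (ha : ∀ i, 0 < a i) (haδ : a δ = 1) (hbδ : b δ = 0) (u s : V → ℝ) :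
    (∑ i : {i : V // i ≠ δ},
          (((a i.1) ^ 2 + (b i.1) ^ 2 - 1) * betaW W (Smap a b (u, s)).1 i.1
            + b i.1 * thetaW W (Smap a b (u, s)).1 (Smap a b (u, s)).2 i.1))
      + (1 / 2) * ∑ i, ∑ j, (Smap a b (u, s)).2 i * Amat W (Smap a b (u, s)).1 i j
          * (Smap a b (u, s)).2 j
      + (1 / 2) * ∑ i, ∑ j, W i j *
          (Real.cosh ((Smap a b (u, s)).1 i - (Smap a b (u, s)).1 j) - 1)
    = (1 / 2) * ∑ i, ∑ j, W i j * (a i * a j + b i * b j - 1)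
      + (1 / 2) * ∑ i, ∑ j, s i * Amat (fun i j => a i * a j * W i j) u i j * s j
      + (1 / 2) * ∑ i, ∑ j, a i * a j * W i j * (Real.cosh (u i - u j) - 1) := by
  rw [sum_subtype_zero δ (fun i => (((a i) ^ 2 + (b i) ^ 2 - 1) * betaW W (Smap a b (u, s)).1 i
            + b i * thetaW W (Smap a b (u, s)).1 (Smap a b (u, s)).2 i)) (by simp [haδ, hbδ]),
    Amat_quad W hdiag, Amat_quad _ (by simp [hdiag])]
  simp only [betaW, thetaW, Finset.mul_sum, ← Finset.sum_add_distrib]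
  apply sum_symm_eq
  intro i j
  rw [hsymm j i]
  have hi := ha i
  have hj := ha j
  simp only [Smap, Real.cosh_eq, neg_sub, Real.exp_add, Real.exp_sub, Real.exp_neg,
    Real.exp_log hi, Real.exp_log hj]
  have xi := Real.exp_pos (u i)
  have xj := Real.exp_pos (u j)
  generalize Real.exp (u i) = x at *
  generalize Real.exp (u j) = y at *
  field_simp
  ring

lemma density_id {V : Type*} [Fintype V] [DecidableEq V] (W : V → V → ℝ) (δ : V)
    (hsymm : ∀ i j, W i j = W j i) (hdiag : ∀ i, W i i = 0)
    (a b : V → ℝ) (ha : ∀ i, 0 < a i) (haδ : a δ = 1) (hbδ : b δ = 0) 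
    (p : (V → ℝ) × (V → ℝ)) :
    Real.exp (-(∑ i : {i : V // i ≠ δ},
          (((a i.1) ^ 2 + (b i.1) ^ 2 - 1) * betaW W (Smap a b p).1 i.1
            + b i.1 * thetaW W (Smap a b p).1 (Smap a b p).2 i.1)))
      * (rhoW W δ (Smap a b p).1 (Smap a b p).2 *
        ∏ i : {i : V // i ≠ δ}, Real.exp (-((Smap a b p).1 i.1)) / (2 * Real.pi))
    = LW W δ a b * (rhoW (fun i j => a i * a j * W i j) δ p.1 p.2 *
        ∏ i : {i : V // i ≠ δ}, Real.exp (-(p.1 i.1)) / (2 * Real.pi)) := by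
  obtain ⟨u, s⟩ := p
  have hexp := exponent_id W δ hsymm hdiag a b ha haδ hbδ u s
  have hdet : AVV W δ (Smap a b (u, s)).1 = AVV (fun i j => a i * a j * W i j) δ u := by
    unfold AVV
    simp only [Smap, Amat_scale W a ha u]
  have hprod : ∏ i : {i : V // i ≠ δ}, Real.exp (-((Smap a b (u, s)).1 i.1)) / (2 * Real.pi)
      = (∏ i : {i : V // i ≠ δ}, (a i.1)⁻¹)
        * ∏ i : {i : V // i ≠ δ}, Real.exp (-(u i.1)) / (2 * Real.pi) := by
    rw [← Finset.prod_mul_distrib]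
    refine Finset.prod_congr rfl fun i _ => ?_
    simp only [Smap, neg_add, Real.exp_add, Real.exp_neg (Real.log _), Real.exp_log (ha _)]
    ring
  rw [hprod]
  unfold rhoW LW
  rw [hdet]
  have key : ∀ A B C D E F d P Q : ℝ, A + B + C = D + E + F →
      Real.exp (-A) * (Real.exp (-B) * d * Real.exp (-C) * (P * Q))
      = Real.exp (-D) * P * (Real.exp (-E) * d * Real.exp (-F) * Q) := by
    intro A B C D E F d P Q h
    have h1 : Real.exp (-A) * Real.exp (-B) * Real.exp (-C)
        = Real.exp (-D) * Real.exp (-E) * Real.exp (-F) := by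
      simp only [← Real.exp_add]
      congr 1
      linarith
    linear_combination (d * P * Q) * h1
  simp only [neg_mul]
  exact key _ _ _ _ _ _ _ _ _ hexp

lemma measurable_extend {V : Type*} [Fintype V] [DecidableEq V] (δ : V) :
    Measurable (extendByZero δ) := by
  refine measurable_pi_lambda _ fun i => ?_
  unfold extendByZero
  by_cases h : i = δ
  · simp [h]
  · simpa [h] using measurable_pi_apply _

lemma measurable_density {V : Type*} [Fintype V] [DecidableEq V] (W : V → V → ℝ) (δ : V) :
    Measurable fun p : (V → ℝ) × (V → ℝ) => ENNReal.ofReal (rhoW W δ p.1 p.2 *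
      ∏ i : {i : V // i ≠ δ}, Real.exp (-(p.1 i.1)) / (2 * Real.pi)) := by
  have hA : ∀ i j, Continuous fun p : (V → ℝ) × (V → ℝ) => Amat W p.1 i j := by
    intro i j
    by_cases h : i = j
    · simp only [Amat, Matrix.of_apply, h, if_true]
      fun_prop
    · simp only [Amat, Matrix.of_apply, h, if_false]
      fun_prop
  have hD : Continuous fun p : (V → ℝ) × (V → ℝ) => (AVV W δ p.1).det := by
    apply Continuous.matrix_det
    refine continuous_pi fun i => continuous_pi fun j => ?_
    exact hA _ _
  refine ENNReal.measurable_ofReal.comp (Continuous.measurable ?_)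
  unfold rhoW
  fun_prop

lemma lintegral_muW {V : Type*} [Fintype V] [DecidableEq V] (W : V → V → ℝ) (δ : V)
    (g : (V → ℝ) × (V → ℝ) → ENNReal) (hg : Measurable g) :
    ∫⁻ p, g p ∂(muW W δ) = ∫⁻ p, ENNReal.ofReal (rhoW W δ p.1 p.2 *
      ∏ i : {i : V // i ≠ δ}, Real.exp (-(p.1 i.1)) / (2 * Real.pi)) * g p ∂(baseMeasure δ) := by
  unfold muW
  rw [lintegral_withDensity_eq_lintegral_mul _ (measurable_density W δ) hg]
  rfl

lemma measurable_Smap {V : Type*} [Fintype V] (a b : V → ℝ) : Measurable (Smap a b) := by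
  apply Continuous.measurable
  unfold Smap
  fun_prop

lemma lintegral_base_shift {V : Type*} [Fintype V] [DecidableEq V] (δ : V)
    (a b : V → ℝ) (haδ : a δ = 1) (hbδ : b δ = 0)
    (g : (V → ℝ) × (V → ℝ) → ENNReal) (hg : Measurable g) :
    ∫⁻ p, g p ∂(baseMeasure δ) = ∫⁻ p, g (Smap a b p) ∂(baseMeasure δ) := by
  have hm : Measurable (fun p : ({i : V // i ≠ δ} → ℝ) × ({i : V // i ≠ δ} → ℝ) =>
      (extendByZero δ p.1, extendByZero δ p.2)) :=
    ((measurable_extend δ).comp measurable_fst).prodMk ((measurable_extend δ).comp measurable_snd)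
  have hgS : Measurable fun p => g (Smap a b p) := hg.comp (measurable_Smap a b)
  have hgm : Measurable fun p : ({i : V // i ≠ δ} → ℝ) × ({i : V // i ≠ δ} → ℝ) =>
      g (extendByZero δ p.1, extendByZero δ p.2) := hg.comp hm
  have hgSm : Measurable fun p : ({i : V // i ≠ δ} → ℝ) × ({i : V // i ≠ δ} → ℝ) =>
      g (Smap a b (extendByZero δ p.1, extendByZero δ p.2)) := hgS.comp hm
  unfold baseMeasure
  rw [lintegral_map hg hm, lintegral_map hgS hm, Measure.volume_eq_prod,
    lintegral_prod _ hgm.aemeasurable, lintegral_prod _ hgSm.aemeasurable]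
  have hS : ∀ x y : {i : V // i ≠ δ} → ℝ, Smap a b (extendByZero δ x, extendByZero δ y)
      = (extendByZero δ (x + fun i => Real.log (a i.1)),
        extendByZero δ (y + fun i => -(Real.exp (-(x i)) * b i.1 / a i.1))) := by
    intro x y
    refine Prod.ext ?_ ?_ <;> funext i <;> by_cases h : i = δ
    · subst h; simp [Smap, extendByZero, haδ]
    · simp [Smap, extendByZero, h]
    · subst h; simp [Smap, extendByZero, hbδ]
    · simp [Smap, extendByZero, h, sub_eq_add_neg]
  simp only [hS]
  rw [← lintegral_add_right_eq_self _ (fun i : {i : V // i ≠ δ} => Real.log (a i.1))]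
  refine lintegral_congr fun x => ?_
  rw [← lintegral_add_right_eq_self _
    (fun i : {i : V // i ≠ δ} => -(Real.exp (-(x i)) * b i.1 / a i.1))]

/-- for every Borel measurable `f : Ω_V → [0,∞]`,
`∫ f·exp(−Σ_{i∈V}[(a_i²+b_i²−1)β_i + b_i θ_i]) dμ^W = L^W(a,b)·∫ f∘S_{[a,b]} dμ^{W^a}`;
equivalently, the image of `μ^{W^a}` under `S_{[a,b]}` is absolutely continuous with
respect to `μ^W` with the stated Radon–Nikodym derivative. -/
theorem stmt0 {V : Type*} [Fintype V] [DecidableEq V]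
    (W : V → V → ℝ) (δ : V)
    (hsymm : ∀ i j, W i j = W j i)
    (hdiag : ∀ i, W i i = 0)
    (hnonneg : ∀ i j, 0 ≤ W i j)
    (hconn : (SimpleGraph.fromRel fun i j : V => 0 < W i j).Connected)
    (a b : V → ℝ) (ha : ∀ i, 0 < a i) (haδ : a δ = 1) (hbδ : b δ = 0)
    (f : (V → ℝ) × (V → ℝ) → ENNReal) (hf : Measurable f) :
    ∫⁻ p, f p * ENNReal.ofReal
        (Real.exp (-(∑ i : {i : V // i ≠ δ},
          (((a i.1) ^ 2 + (b i.1) ^ 2 - 1) * betaW W p.1 i.1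
            + b i.1 * thetaW W p.1 p.2 i.1)))) ∂(muW W δ)
      = ENNReal.ofReal (LW W δ a b) *
        ∫⁻ p, f (Smap a b p) ∂(muW (fun i j => a i * a j * W i j) δ) := by
  have hE : Measurable fun p : (V → ℝ) × (V → ℝ) => ENNReal.ofReal
        (Real.exp (-(∑ i : {i : V // i ≠ δ},
          (((a i.1) ^ 2 + (b i.1) ^ 2 - 1) * betaW W p.1 i.1
            + b i.1 * thetaW W p.1 p.2 i.1)))) := by
    refine ENNReal.measurable_ofReal.comp (Continuous.measurable ?_)
    unfold betaW thetaW
    fun_prop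
  have hfS : Measurable fun p => f (Smap a b p) := hf.comp (measurable_Smap a b)
  rw [lintegral_muW W δ (fun p => f p * _) (hf.mul hE), lintegral_muW _ _ _ hfS,
    lintegral_base_shift δ a b haδ hbδ (fun p => _ * (f p * _))
      ((measurable_density W δ).mul (hf.mul hE)),
    ← lintegral_const_mul' _ _ ENNReal.ofReal_ne_top]
  refine lintegral_congr fun p => ?_
  have h := density_id W δ hsymm hdiag a b ha haδ hbδ p
  have hL : 0 ≤ LW W δ a b := by
    unfold LW
    exact mul_nonneg (Real.exp_pos _).le
      (Finset.prod_nonneg fun i _ => (inv_pos.mpr (ha _)).le)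
  have h' := congrArg ENNReal.ofReal h
  rw [ENNReal.ofReal_mul (Real.exp_pos _).le, ENNReal.ofReal_mul hL] at h'
  rw [← mul_assoc (ENNReal.ofReal (LW W δ a b)), ← h']
  ring
end
end

section
/- (Kolmogorov consistency.) Let a∈(0,∞)^{Ṽ_{n+1}} and b∈ℝ^{Ṽ_{n+1}} satisfy a_i=1 and b_i=0 for all i∈Ṽ_{n+1}∖V_n. Then ∫ exp(−Σ_{j∈V_n}[(a_j²+b_j²−1)β^{V_n}_j(u)+b_jθ^{V_n}_j(u,s)]) dμ^W_n(u,s) = ∫ exp(−Σ_{j∈V_n}[(a_j²+b_j²−1)β^{V_{n+1}}_j(u)+b_jθ^{V_{n+1}}_j(u,s)]) dμ^W_{n+1}(u,s). Consequently the law of (β^{V_n},θ^{V_n}) under μ^W_n agrees with the law of ((β^{V_{n+1}}_i)_{i∈V_n},(θ^{V_{n+1}}_i)_{i∈V_n}) under μ^W_{n+1}. -/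
open MeasureTheory Real Finset BigOperators

noncomputable section

/-- The weights of the wired finite graph `G̃_S` with vertex set `S ∪ {δ_S}`, encoded as
`Option {i // i ∈ S}` with `none` playing the role of the distinguished vertex `δ_S`:
`W^{(S)}_{ij} = W_{ij}` for `i,j ∈ S` and `W^{(S)}_{iδ_S} = Σ_{j∉S} W_{ij}`. -/
def wiredW {Vinf : Type*} (W : Vinf → Vinf → ℝ) (S : Finset Vinf) :
    Option {i : Vinf // i ∈ S} → Option {i : Vinf // i ∈ S} → ℝ
  | some i, some j => W i.1 j.1
  | some i, none => ∑' j : {j : Vinf // j ∉ S}, W i.1 j.1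
  | none, some j => ∑' k : {k : Vinf // k ∉ S}, W j.1 k.1
  | none, none => 0


/-! ### One-dimensional integrals -/

lemma kc_gauss (y m : ℝ) (hy : 0 < y) :
    ∫⁻ t : ℝ, ENNReal.ofReal (Real.exp (-(1/2) * ((t + m) ^ 2 / y)))
      = ENNReal.ofReal (Real.sqrt (2 * Real.pi * y)) := by
  rw [lintegral_add_right_eq_self (μ := (volume : Measure ℝ))
    (fun t : ℝ => ENNReal.ofReal (Real.exp (-(1/2) * (t ^ 2 / y)))) m]
  have h1 : (fun t : ℝ => Real.exp (-(1/2) * (t ^ 2 / y)))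
      = fun t : ℝ => Real.exp (-(1 / (2 * y)) * t ^ 2) := by
    funext t; congr 1; field_simp
  rw [← ofReal_integral_eq_lintegral_ofReal]
  · rw [h1, integral_gaussian]
    congr 2; field_simp
  · rw [h1]; exact integrable_exp_neg_mul_sq (by positivity)
  · exact Filter.Eventually.of_forall fun t => (Real.exp_pos _).le

lemma kc_gauss_half :
    ∫⁻ t in Set.Ioi (0:ℝ), ENNReal.ofReal (Real.exp (-(1/2) * t ^ 2))
      = ENNReal.ofReal (Real.sqrt (2 * Real.pi) / 2) := by
  rw [← ofReal_integral_eq_lintegral_ofReal]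
  · rw [integral_gaussian_Ioi]
    congr 3; ring
  · exact (integrable_exp_neg_mul_sq (by positivity)).integrableOn
  · exact Filter.Eventually.of_forall fun t => (Real.exp_pos _).le

lemma kc_cs (c : ℝ) (hc : 0 ≤ c) :
    ∫⁻ x in Set.Ioi (0:ℝ), ENNReal.ofReal (Real.exp (-(1/2) * (x - c / x) ^ 2))
      = ENNReal.ofReal (Real.sqrt (2 * Real.pi) / 2) := by
  rcases hc.eq_or_lt with rfl | hc
  · simpa using kc_gauss_half
  set F : ℝ → ENNReal := fun t => ENNReal.ofReal (Real.exp (-(1/2) * t ^ 2)) with hF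
  have hFm : Measurable F := by fun_prop
  -- first change of variables
  have e1 : ∫⁻ t, F t = ∫⁻ x in Set.Ioi (0:ℝ), ENNReal.ofReal (1 + c / x ^ 2) * F (x - c / x) := by
    have himg : (fun x : ℝ => x - c / x) '' Set.Ioi 0 = Set.univ := by
      apply Set.eq_univ_of_forall
      intro t
      have hs : |t| < Real.sqrt (t ^ 2 + 4 * c) := by
        rw [← Real.sqrt_sq_eq_abs]
        exact Real.sqrt_lt_sqrt (by positivity) (by linarith)
      have hsq := Real.sq_sqrt (show 0 ≤ t ^ 2 + 4 * c by positivity)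
      set r := Real.sqrt (t ^ 2 + 4 * c)
      have hpos : 0 < t + r := by linarith [neg_abs_le t]
      refine ⟨(t + r) / 2, by simpa using hpos, ?_⟩
      simp only
      field_simp
      nlinarith
    have := lintegral_image_eq_lintegral_abs_deriv_mul (s := Set.Ioi (0:ℝ))
      (f := fun x : ℝ => x - c / x) (f' := fun x => 1 + c / x ^ 2) measurableSet_Ioi ?_ ?_ F
    · rw [himg, Measure.restrict_univ] at this
      rw [this]
      refine setLIntegral_congr_fun measurableSet_Ioi fun x hx => ?_
      rw [abs_of_pos (by have : (0:ℝ) < x := hx; positivity)]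
    · intro x hx
      have hx0 : x ≠ 0 := ne_of_gt hx
      have h := (hasDerivAt_id x).sub ((hasDerivAt_inv hx0).const_mul c)
      refine HasDerivAt.hasDerivWithinAt ?_
      refine (HasDerivAt.congr_deriv h (by ring)).congr_of_eventuallyEq ?_
      exact Filter.Eventually.of_forall fun z => by simp [div_eq_mul_inv]
    · intro x hx y hy hxy
      have hx0 : (0:ℝ) < x := hx
      have hy0 : (0:ℝ) < y := hy
      simp only at hxy
      have h2 : (x - y) * (x * y + c) = 0 := by
        field_simp at hxy
        nlinarith
      have : x * y + c ≠ 0 := by positivity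
      have := (mul_eq_zero.mp h2).resolve_right this
      linarith
  have e2 : ∫⁻ x in Set.Ioi (0:ℝ), F (x - c / x)
      = ∫⁻ x in Set.Ioi (0:ℝ), ENNReal.ofReal (c / x ^ 2) * F (x - c / x) := by
    have himg : (fun x : ℝ => c / x) '' Set.Ioi 0 = Set.Ioi 0 := by
      ext y
      constructor
      · rintro ⟨x, hx, rfl⟩
        have : (0:ℝ) < x := hx
        exact div_pos hc this
      · intro hy
        have : (0:ℝ) < y := hy
        exact ⟨c / y, div_pos hc this, by simp only; field_simp⟩
    have := lintegral_image_eq_lintegral_abs_deriv_mul (s := Set.Ioi (0:ℝ))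
      (f := fun x : ℝ => c / x) (f' := fun x => - (c / x ^ 2)) measurableSet_Ioi ?_ ?_
      (fun x => F (x - c / x))
    · rw [himg] at this
      rw [this]
      refine setLIntegral_congr_fun measurableSet_Ioi fun x hx => ?_
      have hx0 : (0:ℝ) < x := hx
      rw [abs_neg, abs_of_pos (by positivity)]
      congr 1
      simp only [hF]
      congr 3
      field_simp
      ring
    · intro x hx
      have hx0 : x ≠ 0 := ne_of_gt hx
      have h := ((hasDerivAt_inv hx0).const_mul c)
      refine HasDerivAt.hasDerivWithinAt ?_
      refine (HasDerivAt.congr_deriv h (by ring)).congr_of_eventuallyEq ?_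
      exact Filter.Eventually.of_forall fun z => by simp [div_eq_mul_inv]
    · intro x hx y hy hxy
      have hx0 : (0:ℝ) < x := hx
      have hy0 : (0:ℝ) < y := hy
      simp only at hxy
      field_simp at hxy
      exact hxy.symm
  have e3 : ∫⁻ t, F t = 2 * ∫⁻ x in Set.Ioi (0:ℝ), F (x - c / x) := by
    rw [e1, two_mul]
    conv_rhs => rw [e2]
    conv_rhs => enter [1]; rw [← e2]
    rw [← lintegral_add_left (by fun_prop)]
    refine setLIntegral_congr_fun measurableSet_Ioi fun x hx => ?_
    have hx0 : (0:ℝ) < x := hx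
    rw [ENNReal.ofReal_add (by norm_num) (by positivity), add_mul]
    simp
  have e4 := kc_gauss 1 0 one_pos
  have e5 : ∫⁻ t, F t = ENNReal.ofReal (Real.sqrt (2 * Real.pi)) := by
    simpa [hF] using e4
  rw [e5] at e3
  have : ENNReal.ofReal (Real.sqrt (2 * Real.pi))
      = 2 * ENNReal.ofReal (Real.sqrt (2 * Real.pi) / 2) := by
    rw [show (2 : ENNReal) = ENNReal.ofReal 2 by simp, ← ENNReal.ofReal_mul (by norm_num)]
    congr 1; ring
  rw [this] at e3
  exact ((ENNReal.mul_right_inj (by norm_num) (by norm_num)).mp e3).symm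

/-- The inverse Gaussian integral. -/
lemma kc_invgauss (c : ℝ) (hc : 0 ≤ c) :
    ∫⁻ y in Set.Ioi (0:ℝ), ENNReal.ofReal ((Real.sqrt y)⁻¹ * Real.exp (-(1/2) * (y + c ^ 2 / y)))
      = ENNReal.ofReal (Real.sqrt (2 * Real.pi) * Real.exp (-c)) := by
  have himg : (fun x : ℝ => x ^ 2) '' Set.Ioi 0 = Set.Ioi 0 := by
    ext y
    constructor
    · rintro ⟨x, hx, rfl⟩
      have : (0:ℝ) < x := hx
      exact pow_pos this 2
    · intro hy
      have : (0:ℝ) < y := hy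
      exact ⟨Real.sqrt y, Real.sqrt_pos.2 this, Real.sq_sqrt this.le⟩
  have := lintegral_image_eq_lintegral_abs_deriv_mul (s := Set.Ioi (0:ℝ))
    (f := fun x : ℝ => x ^ 2) (f' := fun x => 2 * x) measurableSet_Ioi ?_ ?_
    (fun y => ENNReal.ofReal ((Real.sqrt y)⁻¹ * Real.exp (-(1/2) * (y + c ^ 2 / y))))
  · rw [himg] at this
    rw [this]
    have h2 : Set.EqOn (fun x : ℝ => ENNReal.ofReal |2 * x| *
        ENNReal.ofReal ((Real.sqrt (x ^ 2))⁻¹ * Real.exp (-(1/2) * (x ^ 2 + c ^ 2 / x ^ 2))))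
        (fun x => ENNReal.ofReal (2 * Real.exp (-c)) *
          ENNReal.ofReal (Real.exp (-(1/2) * (x - c / x) ^ 2))) (Set.Ioi 0) := by
      intro x hx
      have hx0 : (0:ℝ) < x := hx
      simp only
      rw [abs_of_pos (by positivity), ← ENNReal.ofReal_mul (by positivity),
        ← ENNReal.ofReal_mul (by positivity), Real.sqrt_sq hx0.le, mul_assoc 2 (Real.exp _),
        ← Real.exp_add]
      congr 1
      rw [show -c + -(1/2) * (x - c / x) ^ 2 = -(1/2) * (x ^ 2 + c ^ 2 / x ^ 2) by
        field_simp; ring]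
      field_simp
    rw [setLIntegral_congr_fun measurableSet_Ioi h2, lintegral_const_mul _ (by fun_prop),
      kc_cs c hc, ← ENNReal.ofReal_mul (by positivity)]
    congr 1; ring
  · intro x hx
    have := (hasDerivAt_pow 2 x)
    simpa using this.hasDerivWithinAt
  · intro x hx y hy hxy
    have hx0 : (0:ℝ) < x := hx
    have hy0 : (0:ℝ) < y := hy
    simp only at hxy
    exact (pow_left_inj₀ hx0.le hy0.le (by norm_num)).mp hxy

section kcHelpers
open scoped Matrix
set_option linter.unusedSectionVars false

/-! ### The joint density of `(β, θ)` -/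

/-- The matrix `H_β`. -/
def kcH {ι : Type*} [DecidableEq ι] (W : ι → ι → ℝ) (β : ι → ℝ) : Matrix ι ι ℝ :=
  Matrix.of fun i j => if i = j then 2 * β i else -W i j

/-- Real-valued density, without the indicator. -/
def kcR {ι : Type*} [Fintype ι] [DecidableEq ι] (W : ι → ι → ℝ) (η : ι → ℝ) (β θ : ι → ℝ) : ℝ :=
  (Real.pi ^ Fintype.card ι)⁻¹ * ((kcH W β).det)⁻¹ *
    Real.exp (-(1/2) * ((∑ i, ∑ j, kcH W β i j) + η ⬝ᵥ ((kcH W β)⁻¹ *ᵥ η)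
      + θ ⬝ᵥ ((kcH W β)⁻¹ *ᵥ θ)) + ∑ i, η i)

open Classical in
/-- The joint density of `(β, θ)`. -/
def kcD {ι : Type*} [Fintype ι] [DecidableEq ι] (W : ι → ι → ℝ) (η : ι → ℝ) (β θ : ι → ℝ) :
    ENNReal :=
  if (kcH W β).PosDef then ENNReal.ofReal (kcR W η β θ) else 0

section
variable {ι κ : Type*} [Fintype ι] [DecidableEq ι] [Fintype κ] [DecidableEq κ]

lemma kcH_cont (W : ι → ι → ℝ) : Continuous (kcH W) := by
  refine continuous_matrix fun i j => ?_
  simp only [kcH, Matrix.of_apply]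
  split_ifs <;> fun_prop

lemma kcH_inv_meas (W : ι → ι → ℝ) (i j : ι) : Measurable fun β => (kcH W β)⁻¹ i j := by
  simp only [Matrix.inv_def, Ring.inverse_eq_inv', Matrix.smul_apply, smul_eq_mul]
  have h1 : Measurable fun β => (kcH W β).det := (kcH_cont W).matrix_det.measurable
  have h2 : Measurable fun β => (kcH W β).adjugate i j :=
    ((kcH_cont W).matrix_adjugate.matrix_elem i j).measurable
  exact h1.inv.mul h2

lemma kcR_meas (W : ι → ι → ℝ) (η : ι → ℝ) :
    Measurable fun p : (ι → ℝ) × (ι → ℝ) => kcR W η p.1 p.2 := by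
  have h1 : Measurable fun β => (kcH W β).det := (kcH_cont W).matrix_det.measurable
  have h3 : ∀ i j, Measurable fun β => kcH W β i j := fun i j =>
    ((kcH_cont W).matrix_elem i j).measurable
  have h4 := kcH_inv_meas W
  have h1' : Measurable fun p : (ι → ℝ) × (ι → ℝ) => (kcH W p.1).det := h1.comp measurable_fst
  have h3' : ∀ i j, Measurable fun p : (ι → ℝ) × (ι → ℝ) => kcH W p.1 i j :=
    fun i j => (h3 i j).comp measurable_fst
  have h4' : ∀ i j, Measurable fun p : (ι → ℝ) × (ι → ℝ) => (kcH W p.1)⁻¹ i j :=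
    fun i j => (h4 i j).comp measurable_fst
  have h5 : Measurable fun p : (ι → ℝ) × (ι → ℝ) => ∑ i, ∑ j, kcH W p.1 i j :=
    Finset.measurable_sum _ fun i _ => Finset.measurable_sum _ fun j _ => h3' i j
  have h6 : ∀ v : (ι → ℝ) × (ι → ℝ) → ι → ℝ, Measurable v →
      Measurable fun p : (ι → ℝ) × (ι → ℝ) => v p ⬝ᵥ ((kcH W p.1)⁻¹ *ᵥ v p) := by
    intro v hv
    have hv' : ∀ i, Measurable fun p => v p i := fun i => (measurable_pi_apply i).comp hv
    simp only [dotProduct, Matrix.mulVec]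
    exact Finset.measurable_sum _ fun i _ => (hv' i).mul
      (Finset.measurable_sum _ fun j _ => (h4' i j).mul (hv' j))
  unfold kcR
  exact (measurable_const.mul h1'.inv).mul (Real.measurable_exp.comp
    ((measurable_const.mul ((h5.add (h6 _ measurable_const)).add (h6 _ measurable_snd))).add
      measurable_const))

lemma kc_posDef_iff (M : Matrix ι ι ℝ) : M.PosDef ↔ M.PosSemidef ∧ M.det ≠ 0 := by
  constructor
  · intro h
    exact ⟨h.posSemidef, h.det_pos.ne'⟩
  · rintro ⟨h, hd⟩
    refine Matrix.PosDef.of_dotProduct_mulVec_pos h.1 fun x hx => ?_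
    refine lt_of_le_of_ne (h.dotProduct_mulVec_nonneg x) fun h0 => hx ?_
    have := (h.dotProduct_mulVec_zero_iff x).mp h0.symm
    exact Matrix.eq_zero_of_mulVec_eq_zero hd this

lemma kcH_posDef_meas (W : ι → ι → ℝ) : MeasurableSet {β | (kcH W β).PosDef} := by
  simp only [kc_posDef_iff, Set.ofPred_and]
  have h1 : Measurable fun β => (kcH W β).det := (kcH_cont W).matrix_det.measurable
  refine MeasurableSet.inter ?_ ?_
  · simp only [Matrix.posSemidef_iff_dotProduct_mulVec, Set.ofPred_and, Set.ofPred_forall]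
    refine (IsClosed.inter ?_ ?_).measurableSet
    · exact isClosed_eq (kcH_cont W).matrix_conjTranspose (kcH_cont W)
    · refine isClosed_iInter fun x => isClosed_le continuous_const ?_
      have := kcH_cont W
      fun_prop
  · exact (h1 (measurableSet_singleton (0:ℝ))).compl

lemma kcD_meas (W : ι → ι → ℝ) (η : ι → ℝ) :
    Measurable fun p : (ι → ℝ) × (ι → ℝ) => kcD W η p.1 p.2 := by
  unfold kcD
  refine Measurable.ite ?_ (kcR_meas W η).ennreal_ofReal measurable_const
  exact (kcH_posDef_meas W).preimage measurable_fst

lemma kcH_reindex (e : κ ≃ ι) (W : ι → ι → ℝ) (β : ι → ℝ) :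
    kcH (fun i j => W (e i) (e j)) (fun i => β (e i)) = (kcH W β).submatrix e e := by
  ext i j
  simp [kcH]

lemma kcD_reindex (e : κ ≃ ι) (W : ι → ι → ℝ) (η β θ : ι → ℝ) :
    kcD (fun i j => W (e i) (e j)) (fun i => η (e i)) (fun i => β (e i)) (fun i => θ (e i))
      = kcD W η β θ := by
  have hq : ∀ v : ι → ℝ, (fun i => v (e i)) ⬝ᵥ (((kcH W β).submatrix e e)⁻¹ *ᵥ fun i => v (e i))
      = v ⬝ᵥ ((kcH W β)⁻¹ *ᵥ v) := by
    intro v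
    rw [Matrix.inv_submatrix_equiv]
    simp only [dotProduct, Matrix.mulVec, Matrix.submatrix_apply]
    rw [← e.sum_comp]
    refine Finset.sum_congr rfl fun i _ => ?_
    rw [← e.sum_comp (fun j => (kcH W β)⁻¹ (e i) j * v j)]
  have hpd : ((kcH W β).submatrix e e).PosDef ↔ (kcH W β).PosDef := by
    constructor
    · intro h
      have := h.submatrix e.symm.injective
      simpa using this
    · intro h
      exact h.submatrix e.injective
  have hs : ∑ i, ∑ j, (kcH W β).submatrix e e i j = ∑ i, ∑ j, kcH W β i j := by
    rw [← e.sum_comp]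
    refine Finset.sum_congr rfl fun i _ => ?_
    rw [← e.sum_comp]; rfl
  unfold kcD kcR
  classical
  refine if_congr (by rw [kcH_reindex, hpd]) ?_ rfl
  simp only [kcH_reindex, Matrix.det_submatrix_equiv_self, hq, hs, Fintype.card_congr e,
    e.sum_comp]

/-- M-matrix property. -/
lemma kc_Mmatrix (W : ι → ι → ℝ) (hW : ∀ i j, 0 ≤ W i j) (β : ι → ℝ)
    (hH : (kcH W β).PosDef) (x : ι → ℝ) (hx : ∀ i, 0 ≤ (kcH W β *ᵥ x) i) : ∀ i, 0 ≤ x i := by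
  set n : ι → ℝ := fun i => max (-x i) 0 with hn
  by_contra hcon
  push Not at hcon
  obtain ⟨i0, hi0⟩ := hcon
  have hn0 : n ≠ 0 := by
    intro h
    have := congrFun h i0
    simp only [hn, Pi.zero_apply] at this
    have h2 := le_max_left (-x i0) 0
    linarith
  have hpos := hH.dotProduct_mulVec_pos hn0
  have h1 : 0 ≤ n ⬝ᵥ (kcH W β *ᵥ x) :=
    Finset.sum_nonneg fun i _ => mul_nonneg (le_max_right _ _) (hx i)
  have h2 : n ⬝ᵥ (kcH W β *ᵥ x) + n ⬝ᵥ (kcH W β *ᵥ n) ≤ 0 := by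
    rw [← dotProduct_add, ← Matrix.mulVec_add]
    simp only [dotProduct, Matrix.mulVec, Finset.mul_sum]
    refine Finset.sum_nonpos fun i _ => Finset.sum_nonpos fun j _ => ?_
    have hni : 0 ≤ n i := le_max_right _ _
    have hxj : 0 ≤ (x + n) j := by
      simp only [hn, Pi.add_apply]; linarith [le_max_left (-x j) 0]
    by_cases hij : i = j
    · subst hij
      have : n i * (x + n) i = 0 := by
        simp only [hn, Pi.add_apply]
        rcases le_total (-x i) 0 with h | h
        · simp [max_eq_right h]
        · simp [max_eq_left h]
      rw [mul_left_comm, this, mul_zero]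
    · simp only [kcH, Matrix.of_apply, hij, if_false]
      have := mul_nonneg hni (mul_nonneg (hW i j) hxj)
      nlinarith
  simp only [star_trivial] at hpos
  linarith

end

section
variable {κ : Type*} [Fintype κ] [DecidableEq κ]

lemma kcH_symm (W : κ → κ → ℝ) (hs : ∀ i j, W i j = W j i) (β : κ → ℝ) :
    (kcH W β).IsHermitian := by
  ext i j
  simp only [kcH, Matrix.conjTranspose_apply, Matrix.of_apply, star_trivial]
  by_cases h : i = j
  · subst h; simp
  · rw [if_neg h, if_neg (Ne.symm h), hs]

variable (W : κ ⊕ Unit → κ ⊕ Unit → ℝ)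

lemma kcH_blocks (hs : ∀ i j, W i j = W j i) (β : κ → ℝ) (x : ℝ) :
    kcH W (Sum.elim β fun _ => x) = Matrix.fromBlocks (kcH (fun i j => W (.inl i) (.inl j)) β)
      (Matrix.of fun i _ => -W (.inl i) (.inr ())) (Matrix.of fun i _ => -W (.inl i) (.inr ()))ᴴ
      (Matrix.of fun _ _ => 2 * x) := by
  ext i j
  rcases i with i | i <;> rcases j with j | j <;> simp [kcH, hs]

/-- Schur complement facts. -/
lemma kc_schur (hs : ∀ i j, W i j = W j i) (β : κ → ℝ) (x : ℝ)
    (hH : (kcH (fun i j => W (.inl i) (.inl j)) β).PosDef) (w : κ → ℝ)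
    (hw : w = fun i => W (.inl i) (.inr ())) (y : ℝ)
    (hy : y = 2 * x - w ⬝ᵥ ((kcH (fun i j => W (.inl i) (.inl j)) β)⁻¹ *ᵥ w)) :
    (kcH W (Sum.elim β fun _ => x)).det = (kcH (fun i j => W (.inl i) (.inl j)) β).det * y ∧
    ((kcH W (Sum.elim β fun _ => x)).PosDef ↔ 0 < y) := by
  set A := kcH (fun i j => W (.inl i) (.inl j)) β with hA
  let _ : Invertible A := hH.isUnit.invertible
  have hB : (Matrix.of fun (_ : Unit) (_ : Unit) => 2 * x)
      - (Matrix.of fun i (_ : Unit) => -W (.inl i) (.inr ()))ᴴ * A⁻¹ *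
        (Matrix.of fun i (_ : Unit) => -W (.inl i) (.inr ()))
      = Matrix.diagonal fun _ : Unit => y := by
    ext i j
    rw [hy, hw]
    simp only [Matrix.sub_apply, Matrix.of_apply, Matrix.mul_assoc]
    simp only [Matrix.mul_apply, Matrix.conjTranspose_apply, Matrix.of_apply, star_trivial,
      dotProduct, Matrix.mulVec]
    simp
  have hdet : (kcH W (Sum.elim β fun _ => x)).det = A.det * y := by
    rw [kcH_blocks W hs, ← hA, Matrix.det_fromBlocks₁₁, Matrix.invOf_eq_nonsing_inv, hB]
    simp
  refine ⟨hdet, ?_⟩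
  constructor
  · intro h
    have := h.det_pos
    rw [hdet] at this
    exact (mul_pos_iff_of_pos_left hH.det_pos).mp this
  · intro h
    rw [kc_posDef_iff]
    refine ⟨?_, ?_⟩
    · rw [kcH_blocks W hs, ← hA, Matrix.PosDef.fromBlocks₁₁ _ _ hH, hB]
      exact Matrix.PosSemidef.diagonal fun _ => h.le
    · rw [hdet]
      exact mul_ne_zero hH.det_pos.ne' h.ne'

lemma kc_inv_mulVec {n : Type*} [Fintype n] [DecidableEq n] (M : Matrix n n ℝ) (h : M.PosDef)
    (v z : n → ℝ) (hz : M *ᵥ z = v) : M⁻¹ *ᵥ v = z := by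
  rw [← hz, Matrix.mulVec_mulVec, Matrix.nonsing_inv_mul _ ((Matrix.isUnit_iff_isUnit_det _).mp h.isUnit),
    Matrix.one_mulVec]

lemma kc_mulVec_inv {n : Type*} [Fintype n] [DecidableEq n] (M : Matrix n n ℝ) (h : M.PosDef)
    (v : n → ℝ) : M *ᵥ (M⁻¹ *ᵥ v) = v := by
  rw [Matrix.mulVec_mulVec, Matrix.mul_nonsing_inv _ ((Matrix.isUnit_iff_isUnit_det _).mp h.isUnit),
    Matrix.one_mulVec]

lemma kc_symm_dot {n : Type*} [Fintype n] [DecidableEq n] (M : Matrix n n ℝ) (h : M.PosDef)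
    (v w : n → ℝ) : v ⬝ᵥ (M⁻¹ *ᵥ w) = w ⬝ᵥ (M⁻¹ *ᵥ v) := by
  have h1 : (M⁻¹)ᵀ = M⁻¹ := by
    have := h.inv.isHermitian
    rwa [Matrix.IsHermitian, Matrix.conjTranspose_eq_transpose_of_trivial] at this
  rw [Matrix.dotProduct_mulVec, ← Matrix.mulVec_transpose, h1, dotProduct_comm]

lemma kc_quad (hs : ∀ i j, W i j = W j i) (β : κ → ℝ) (x : ℝ)
    (hH : (kcH (fun i j => W (.inl i) (.inl j)) β).PosDef) (w : κ → ℝ)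
    (hw : w = fun i => W (.inl i) (.inr ())) (y : ℝ)
    (hy : y = 2 * x - w ⬝ᵥ ((kcH (fun i j => W (.inl i) (.inl j)) β)⁻¹ *ᵥ w))
    (hy0 : 0 < y) (v : κ → ℝ) (t : ℝ) :
    (Sum.elim v fun _ : Unit => t) ⬝ᵥ ((kcH W (Sum.elim β fun _ => x))⁻¹ *ᵥ (Sum.elim v fun _ => t))
      = v ⬝ᵥ ((kcH (fun i j => W (.inl i) (.inl j)) β)⁻¹ *ᵥ v)
        + (t + w ⬝ᵥ ((kcH (fun i j => W (.inl i) (.inl j)) β)⁻¹ *ᵥ v)) ^ 2 / y := by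
  have hPD := ((kc_schur W hs β x hH w hw y hy).2).mpr hy0
  set A := kcH (fun i j => W (.inl i) (.inl j)) β with hA
  set z1 := (t + w ⬝ᵥ (A⁻¹ *ᵥ v)) / y with hz1
  have hz1y : z1 * y = t + w ⬝ᵥ (A⁻¹ *ᵥ v) := by rw [hz1]; field_simp
  set z' := A⁻¹ *ᵥ (v + z1 • w) with hz'
  have hsol : kcH W (Sum.elim β fun _ => x) *ᵥ (Sum.elim z' fun _ => z1)
      = Sum.elim v fun _ => t := by
    rw [kcH_blocks W hs, Matrix.fromBlocks_mulVec]
    congr 1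
    · rw [← hA]
      simp only [Sum.elim_comp_inl, Sum.elim_comp_inr]
      rw [hz', kc_mulVec_inv A hH]
      ext i
      simp only [Pi.add_apply, Pi.smul_apply, smul_eq_mul, Matrix.mulVec, dotProduct,
        Matrix.of_apply, hw]
      simp
      ring
    · simp only [Sum.elim_comp_inl, Sum.elim_comp_inr]
      ext i
      have e1 : ((Matrix.of fun i (_ : Unit) => -W (.inl i) (.inr ()))ᴴ *ᵥ z') i = - (w ⬝ᵥ z') := by
        simp only [Matrix.mulVec, dotProduct, Matrix.conjTranspose_apply, Matrix.of_apply, hw,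
          star_trivial]
        simp
      have e2 : ((Matrix.of fun (_ : Unit) (_ : Unit) => 2 * x) *ᵥ fun _ => z1) i = 2 * x * z1 := by
        simp [Matrix.mulVec, dotProduct]
      rw [Pi.add_apply, e1, e2, hz', Matrix.mulVec_add, Matrix.mulVec_smul, dotProduct_add,
        dotProduct_smul, smul_eq_mul]
      have : 2 * x = y + w ⬝ᵥ (A⁻¹ *ᵥ w) := by rw [hy]; ring
      rw [this]
      linarith
  rw [kc_inv_mulVec _ hPD _ _ hsol]
  have e3 : (Sum.elim v fun _ : Unit => t) ⬝ᵥ (Sum.elim z' fun _ => z1) = v ⬝ᵥ z' + t * z1 := by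
    simp [dotProduct]
  rw [e3, hz', Matrix.mulVec_add, Matrix.mulVec_smul, dotProduct_add, dotProduct_smul, smul_eq_mul,
    kc_symm_dot A hH v w]
  have : (t + w ⬝ᵥ (A⁻¹ *ᵥ v)) ^ 2 / y = z1 * (t + w ⬝ᵥ (A⁻¹ *ᵥ v)) := by
    rw [hz1]; ring
  rw [this]; ring

/-- Integrating out one vertex. -/
lemma kc_onestep (hs : ∀ i j, W i j = W j i) (hW : ∀ i j, 0 ≤ W i j) (η : κ ⊕ Unit → ℝ)
    (hη : ∀ i, 0 ≤ η i) (β θ : κ → ℝ) :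
    ∫⁻ x : ℝ, ∫⁻ t : ℝ, kcD W η (Sum.elim β fun _ => x) (Sum.elim θ fun _ => t)
      = kcD (fun i j => W (.inl i) (.inl j)) (fun i => η (.inl i) + W (.inl i) (.inr ())) β θ := by
  by_cases hH : (kcH (fun i j => W (.inl i) (.inl j)) β).PosDef
  swap
  · have : ∀ x : ℝ, ¬ (kcH W (Sum.elim β fun _ => x)).PosDef := by
      intro x h
      apply hH
      have := h.submatrix (e := (Sum.inl : κ → κ ⊕ Unit)) Sum.inl_injective
      rw [kcH_blocks W hs] at this
      exact this
    simp [kcD, hH, this]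
  set w : κ → ℝ := fun i => W (.inl i) (.inr ()) with hw
  set A := kcH (fun i j => W (.inl i) (.inl j)) β with hA
  set η' : κ → ℝ := fun i => η (.inl i) with hη'
  set η1 := η (.inr ()) with hη1
  have hηe : η = Sum.elim η' fun _ => η1 := by
    ext i; rcases i with i | i <;> rfl
  set m := w ⬝ᵥ (A⁻¹ *ᵥ w) with hm
  set c := η1 + w ⬝ᵥ (A⁻¹ *ᵥ η') with hc
  have hc0 : 0 ≤ c := by
    have h1 : ∀ i, 0 ≤ (A⁻¹ *ᵥ η') i := by
      refine kc_Mmatrix _ (fun i j => hW _ _) β hH _ fun i => ?_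
      rw [← hA, kc_mulVec_inv A hH]
      exact hη _
    exact add_nonneg (hη _) (Finset.sum_nonneg fun i _ => mul_nonneg (hW _ _) (h1 i))
  set K := (Real.pi ^ Fintype.card (κ ⊕ Unit))⁻¹ * (A.det)⁻¹ * Real.exp (-(1/2) * ((∑ i, ∑ j, A i j)
      - 2 * ∑ i, w i + m + η' ⬝ᵥ (A⁻¹ *ᵥ η') + θ ⬝ᵥ (A⁻¹ *ᵥ θ)) + (∑ i, η' i + η1)) with hK
  have hdA := hH.det_pos
  have hK0 : 0 ≤ K := by positivity
  -- the density, in terms of y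
  have hdens : ∀ x t : ℝ, kcD W η (Sum.elim β fun _ => x) (Sum.elim θ fun _ => t)
      = if 0 < 2 * x - m then ENNReal.ofReal (K * (2 * x - m)⁻¹ *
          Real.exp (-(1/2) * ((2 * x - m) + c ^ 2 / (2 * x - m)))) *
          ENNReal.ofReal (Real.exp (-(1/2) * ((t + w ⬝ᵥ (A⁻¹ *ᵥ θ)) ^ 2 / (2 * x - m)))) else 0 := by
    intro x t
    obtain ⟨hd, hp⟩ := kc_schur W hs β x hH w hw (2 * x - m) rfl
    unfold kcD
    rw [hp]
    split_ifs with hy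
    · rw [← ENNReal.ofReal_mul (by positivity)]
      congr 1
      unfold kcR
      have hsum : ∑ i, ∑ j, kcH W (Sum.elim β fun _ => x) i j
          = (∑ i, ∑ j, A i j) - 2 * ∑ i, w i + 2 * x := by
        rw [kcH_blocks W hs]
        simp only [Fintype.sum_sum_type, Matrix.fromBlocks_apply₁₁, Matrix.fromBlocks_apply₁₂,
          Matrix.fromBlocks_apply₂₁, Matrix.fromBlocks_apply₂₂, Matrix.conjTranspose_apply,
          Matrix.of_apply, star_trivial]
        simp [Finset.sum_add_distrib, hw]
        ring
      rw [hd, hsum, hηe, kc_quad W hs β x hH w hw _ rfl hy, kc_quad W hs β x hH w hw _ rfl hy,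
        Fintype.sum_sum_type]
      simp only [Sum.elim_inl, Sum.elim_inr, Finset.univ_unique, Finset.sum_singleton]
      rw [hK, mul_inv]
      have e : ∀ a b d e1 e2 e3 : ℝ, a * b * Real.exp e1 * d * Real.exp e2 * Real.exp e3
          = a * (b * d) * Real.exp (e1 + e2 + e3) := by
        intros; rw [Real.exp_add, Real.exp_add]; ring
      rw [e]
      congr 2
      ring
    · rfl
  simp only [hdens]
  have hinner : ∀ x : ℝ, (∫⁻ t : ℝ, if 0 < 2 * x - m then ENNReal.ofReal (K * (2 * x - m)⁻¹ *
          Real.exp (-(1/2) * ((2 * x - m) + c ^ 2 / (2 * x - m)))) *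
          ENNReal.ofReal (Real.exp (-(1/2) * ((t + w ⬝ᵥ (A⁻¹ *ᵥ θ)) ^ 2 / (2 * x - m)))) else 0)
      = (Set.Ioi (0:ℝ)).indicator (fun y => ENNReal.ofReal (K * Real.sqrt (2 * Real.pi)) *
          ENNReal.ofReal ((Real.sqrt y)⁻¹ * Real.exp (-(1/2) * (y + c ^ 2 / y)))) (2 * x - m) := by
    intro x
    by_cases hy : 0 < 2 * x - m
    · simp only [hy, if_true]
      rw [lintegral_const_mul _ (by fun_prop), kc_gauss _ _ hy, Set.indicator_of_mem (by exact hy),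
        ← ENNReal.ofReal_mul (by positivity), ← ENNReal.ofReal_mul (by positivity)]
      congr 1
      set y := 2 * x - m
      have : y⁻¹ * Real.sqrt y = (Real.sqrt y)⁻¹ := by
        have h2 := Real.mul_self_sqrt hy.le
        have h3 := Real.sqrt_pos.2 hy
        field_simp
        nlinarith
      rw [Real.sqrt_mul (by positivity) y, ← this]
      ring
    · simp [hy]
  simp only [hinner]
  set G := (Set.Ioi (0:ℝ)).indicator (fun y => ENNReal.ofReal (K * Real.sqrt (2 * Real.pi)) *
          ENNReal.ofReal ((Real.sqrt y)⁻¹ * Real.exp (-(1/2) * (y + c ^ 2 / y)))) with hG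
  have hsubst : ∫⁻ x : ℝ, G (2 * x - m) = ENNReal.ofReal (1/2) * ∫⁻ y, G y := by
    have h1 := lintegral_image_eq_lintegral_abs_deriv_mul (s := Set.univ)
      (f := fun x : ℝ => 2 * x - m) (f' := fun x => 2) MeasurableSet.univ ?_ ?_ G
    · have himg : (fun x : ℝ => 2 * x - m) '' Set.univ = Set.univ := by
        apply Set.eq_univ_of_forall
        intro t
        exact ⟨(t + m) / 2, trivial, by simp only; ring⟩
      rw [himg, Measure.restrict_univ] at h1
      rw [h1, lintegral_const_mul' _ _ (by simp), ← mul_assoc, ← ENNReal.ofReal_mul (by norm_num)]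
      norm_num
    · intro x _
      have := ((hasDerivAt_id x).const_mul 2).sub_const m
      rw [mul_one] at this
      exact this.hasDerivWithinAt
    · intro x _ y _ h
      simp only at h
      linarith
  rw [hsubst, hG, lintegral_indicator measurableSet_Ioi, lintegral_const_mul _ (by fun_prop),
    kc_invgauss c hc0, ← ENNReal.ofReal_mul (by positivity), ← ENNReal.ofReal_mul (by positivity)]
  unfold kcD
  rw [if_pos hH]
  congr 1
  unfold kcR
  rw [← hA]
  have hη2 : (fun i => η (.inl i) + W (.inl i) (.inr ())) = η' + w := rfl
  have hq : (η' + w) ⬝ᵥ (A⁻¹ *ᵥ (η' + w)) = η' ⬝ᵥ (A⁻¹ *ᵥ η') + 2 * (w ⬝ᵥ (A⁻¹ *ᵥ η')) + m := by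
    rw [Matrix.mulVec_add, dotProduct_add, add_dotProduct, add_dotProduct, kc_symm_dot A hH η' w]
    ring
  have hsum2 : ∑ i, (η' + w) i = ∑ i, η' i + ∑ i, w i :=
    Finset.sum_add_distrib
  rw [hη2, hq, hK]
  erw [hsum2]
  have h2pi := Real.mul_self_sqrt (show 0 ≤ 2 * Real.pi by positivity)
  have e : ∀ a b e1 e2 : ℝ, 1 / 2 * (a * b * Real.exp e1 * Real.sqrt (2 * Real.pi) *
      (Real.sqrt (2 * Real.pi) * Real.exp e2)) = a * Real.pi * b * Real.exp (e1 + e2) := by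
    intros a b e1 e2
    rw [Real.exp_add]
    linear_combination (1 / 2 * a * b * Real.exp e1 * Real.exp e2) * h2pi
  rw [e]
  congr 1
  · congr 1
    rw [Fintype.card_sum, Fintype.card_unit, pow_succ]
    field_simp
  · congr 1
    rw [hc]
    ring
end

section
variable {ι κ : Type*} [Fintype ι] [DecidableEq ι] [Fintype κ] [DecidableEq κ]

attribute [local irreducible] kcD

/-- The law of `(β, θ)`. -/
def kcNu (W : ι → ι → ℝ) (η : ι → ℝ) : Measure ((ι → ℝ) × (ι → ℝ)) :=
  volume.withDensity fun p => kcD W η p.1 p.2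

lemma kc_lint_nu (W : ι → ι → ℝ) (η : ι → ℝ) (h : (ι → ℝ) × (ι → ℝ) → ENNReal) (hh : Measurable h) :
    ∫⁻ p, h p ∂(kcNu W η) = ∫⁻ β : ι → ℝ, ∫⁻ θ : ι → ℝ, kcD W η β θ * h (β, θ) := by
  unfold kcNu
  rw [lintegral_withDensity_eq_lintegral_mul _ (kcD_meas W η) hh, Measure.volume_eq_prod,
    lintegral_prod _ ((kcD_meas W η).mul hh).aemeasurable]
  rfl

lemma kc_mp_reindex (e : κ ≃ ι) :
    MeasurePreserving (fun (x : ι → ℝ) (i : κ) => x (e i)) volume volume := by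
  have := volume_measurePreserving_piCongrLeft (fun _ : κ => ℝ) e.symm
  convert this using 1
  ext x i
  have := MeasurableEquiv.piCongrLeft_apply_apply (β := fun _ : κ => ℝ) e.symm x (e i)
  simpa using this.symm

lemma kcNu_reindex (e : κ ≃ ι) (W : ι → ι → ℝ) (η : ι → ℝ) :
    Measure.map (fun p : (ι → ℝ) × (ι → ℝ) => ((fun i => p.1 (e i)), fun i => p.2 (e i))) (kcNu W η)
      = kcNu (fun i j => W (e i) (e j)) (fun i => η (e i)) := by
  refine Measure.ext_of_lintegral _ fun h hh => ?_
  rw [lintegral_map hh (by fun_prop), kc_lint_nu _ _ _ hh, kc_lint_nu _ _ _ (by fun_prop)]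
  have hm := (kcD_meas (fun i j => W (e i) (e j)) (fun i => η (e i)))
  have hm2 : Measurable fun p : (κ → ℝ) × (κ → ℝ) =>
      kcD (fun i j => W (e i) (e j)) (fun i => η (e i)) p.1 p.2 * h (p.1, p.2) := hm.mul hh
  rw [← (kc_mp_reindex e).lintegral_comp hm2.lintegral_prod_right']
  refine lintegral_congr fun β => ?_
  refine Eq.trans ?_ ((kc_mp_reindex e).lintegral_comp
    (hm2.comp (measurable_prodMk_left (x := fun i => β (e i)))))
  refine lintegral_congr fun θ => ?_
  simp only [kcD_reindex]

lemma kc_mp_sum :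
    MeasurePreserving (fun q : (κ → ℝ) × ℝ => (Sum.elim q.1 fun _ : Unit => q.2)) volume volume := by
  have h1 := volume_measurePreserving_sumPiEquivProdPi_symm (fun _ : κ ⊕ Unit => ℝ)
  have h2 := (volume_preserving_funUnique Unit ℝ).symm
  have h3 := h1.comp ((MeasurePreserving.id (volume : Measure (κ → ℝ))).prod h2)
  have hfun : (fun q : (κ → ℝ) × ℝ => (Sum.elim q.1 fun _ : Unit => q.2))
      = (MeasurableEquiv.sumPiEquivProdPi fun _ : κ ⊕ Unit => ℝ).symm ∘
        Prod.map id (MeasurableEquiv.funUnique Unit ℝ).symm := by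
    funext q
    funext i
    rcases i with i | i
    · rfl
    · rfl
  rw [hfun]
  exact h3

lemma kc_lint_sum (f : (κ ⊕ Unit → ℝ) → ENNReal) (hf : Measurable f) :
    ∫⁻ z, f z = ∫⁻ β : κ → ℝ, ∫⁻ x : ℝ, f (Sum.elim β fun _ => x) := by
  rw [← kc_mp_sum.lintegral_comp hf, Measure.volume_eq_prod]
  exact lintegral_prod (fun q : (κ → ℝ) × ℝ => f (Sum.elim q.1 fun _ : Unit => q.2))
    (hf.comp kc_mp_sum.measurable).aemeasurable

lemma kcNu_onestep_sum (W : κ ⊕ Unit → κ ⊕ Unit → ℝ) (hs : ∀ i j, W i j = W j i)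
    (hW : ∀ i j, 0 ≤ W i j) (η : κ ⊕ Unit → ℝ) (hη : ∀ i, 0 ≤ η i) :
    Measure.map (fun p : (κ ⊕ Unit → ℝ) × (κ ⊕ Unit → ℝ) =>
        ((fun i : κ => p.1 (.inl i)), fun i : κ => p.2 (.inl i))) (kcNu W η)
      = kcNu (fun i j => W (.inl i) (.inl j)) (fun i => η (.inl i) + W (.inl i) (.inr ())) := by
  refine Measure.ext_of_lintegral _ fun h hh => ?_
  rw [lintegral_map hh (by fun_prop), kc_lint_nu _ _ _ hh, kc_lint_nu _ _ _ (by fun_prop)]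
  have hm2 : Measurable fun p : (κ ⊕ Unit → ℝ) × (κ ⊕ Unit → ℝ) =>
      kcD W η p.1 p.2 * h ((fun i : κ => p.1 (.inl i)), fun i : κ => p.2 (.inl i)) :=
    (kcD_meas W η).mul (hh.comp (by fun_prop))
  have hsm : Measurable (fun q : (κ → ℝ) × ℝ => (Sum.elim q.1 fun _ : Unit => q.2)) :=
    kc_mp_sum.measurable
  refine (kc_lint_sum _ hm2.lintegral_prod_right').trans ?_
  refine lintegral_congr fun β => ?_
  have e1 : ∀ x : ℝ, ∫⁻ θ : κ ⊕ Unit → ℝ, kcD W η (Sum.elim β fun _ => x) θ *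
        h ((fun i : κ => (Sum.elim β fun _ : Unit => x) (.inl i)), fun i : κ => θ (.inl i))
      = ∫⁻ θ : κ → ℝ, ∫⁻ t : ℝ, kcD W η (Sum.elim β fun _ => x) (Sum.elim θ fun _ => t) *
          h (β, θ) := by
    intro x
    refine kc_lint_sum (fun θ => kcD W η (Sum.elim β fun _ => x) θ *
        h (β, fun i : κ => θ (.inl i))) ?_
    have h0 : Measurable fun θ : κ ⊕ Unit → ℝ => ((Sum.elim β fun _ : Unit => x), θ) :=
      measurable_const.prodMk measurable_id
    have h1 : Measurable fun θ : κ ⊕ Unit → ℝ => (β, fun i : κ => θ (.inl i)) := by fun_prop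
    exact ((kcD_meas W η).comp h0).mul (hh.comp h1)
  have e2 : ∀ (x : ℝ) (θ : κ → ℝ), Measurable fun t : ℝ =>
      kcD W η (Sum.elim β fun _ => x) (Sum.elim θ fun _ => t) := by
    intro x θ
    have h1 : Measurable fun t : ℝ => (Sum.elim θ fun _ : Unit => t) :=
      hsm.comp (measurable_const.prodMk measurable_id : Measurable fun t : ℝ => (θ, t))
    have h2 : Measurable fun t : ℝ => ((Sum.elim β fun _ : Unit => x), Sum.elim θ fun _ : Unit => t) :=
      measurable_const.prodMk h1
    exact (kcD_meas W η).comp h2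
  have e3 : Measurable fun q : ℝ × (κ → ℝ) × ℝ =>
      kcD W η (Sum.elim β fun _ => q.1) (Sum.elim q.2.1 fun _ => q.2.2) :=
    by
    have h1 : Measurable fun q : ℝ × (κ → ℝ) × ℝ => (Sum.elim β fun _ : Unit => q.1) :=
      hsm.comp (measurable_const.prodMk measurable_fst :
        Measurable fun q : ℝ × (κ → ℝ) × ℝ => (β, q.1))
    have h2 : Measurable fun q : ℝ × (κ → ℝ) × ℝ => (Sum.elim q.2.1 fun _ : Unit => q.2.2) :=
      hsm.comp (measurable_snd : Measurable fun q : ℝ × (κ → ℝ) × ℝ => q.2)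
    exact (kcD_meas W η).comp (h1.prodMk h2)
  have e4 : Measurable fun q : ℝ × (κ → ℝ) => ∫⁻ t : ℝ,
      kcD W η (Sum.elim β fun _ => q.1) (Sum.elim q.2 fun _ => t) := by
    have : Measurable fun q : (ℝ × (κ → ℝ)) × ℝ =>
      kcD W η (Sum.elim β fun _ => q.1.1) (Sum.elim q.1.2 fun _ => q.2) :=
      e3.comp (by fun_prop : Measurable fun q : (ℝ × (κ → ℝ)) × ℝ => (q.1.1, q.1.2, q.2))
    exact this.lintegral_prod_right'
  calc _ = ∫⁻ x : ℝ, ∫⁻ θ : κ → ℝ, (∫⁻ t : ℝ, kcD W η (Sum.elim β fun _ => x)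
              (Sum.elim θ fun _ => t)) * h (β, θ) := by
        refine lintegral_congr fun x => ?_
        refine (e1 x).trans ?_
        refine lintegral_congr fun θ => ?_
        rw [lintegral_mul_const _ (e2 x θ)]
    _ = ∫⁻ θ : κ → ℝ, ∫⁻ x : ℝ, (∫⁻ t : ℝ, kcD W η (Sum.elim β fun _ => x)
              (Sum.elim θ fun _ => t)) * h (β, θ) := by
        refine lintegral_lintegral_swap ?_
        refine (Measurable.mul e4 ?_).aemeasurable
        exact hh.comp (by fun_prop : Measurable fun q : ℝ × (κ → ℝ) => (β, q.2))
    _ = _ := by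
        refine lintegral_congr fun θ => ?_
        have e5 : Measurable fun x : ℝ => ∫⁻ t : ℝ, kcD W η (Sum.elim β fun _ => x)
              (Sum.elim θ fun _ => t) :=
          e4.comp (by fun_prop : Measurable fun x : ℝ => (x, θ))
        rw [lintegral_mul_const _ e5, kc_onestep W hs hW η hη]

lemma kcNu_onestep (e : κ ⊕ Unit ≃ ι) (W : ι → ι → ℝ) (hs : ∀ i j, W i j = W j i)
    (hW : ∀ i j, 0 ≤ W i j) (η : ι → ℝ) (hη : ∀ i, 0 ≤ η i) :
    Measure.map (fun p : (ι → ℝ) × (ι → ℝ) =>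
        ((fun i : κ => p.1 (e (.inl i))), fun i : κ => p.2 (e (.inl i)))) (kcNu W η)
      = kcNu (fun i j => W (e (.inl i)) (e (.inl j)))
          (fun i => η (e (.inl i)) + W (e (.inl i)) (e (.inr ()))) := by
  rw [← kcNu_onestep_sum (fun i j => W (e i) (e j)) (fun i j => hs _ _) (fun i j => hW _ _)
    (fun i => η (e i)) (fun i => hη _), ← kcNu_reindex e, Measure.map_map (by fun_prop) (by fun_prop)]
  rfl
end

section
variable {Vinf : Type*} [DecidableEq Vinf]

/-- The law for the wired graph. -/
def kcNuS (W : Vinf → Vinf → ℝ) (S : Finset Vinf) :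
    Measure (({i // i ∈ S} → ℝ) × ({i // i ∈ S} → ℝ)) :=
  kcNu (fun i j : {i // i ∈ S} => W i.1 j.1) (fun i => ∑' j : {j : Vinf // j ∉ S}, W i.1 j.1)

lemma kc_eta (W : Vinf → Vinf → ℝ) (hnonneg : ∀ i j, 0 ≤ W i j)
    (hlocfin : ∀ i, {j : Vinf | 0 < W i j}.Finite) (S : Finset Vinf) (i : Vinf) :
    ∑' j : {j : Vinf // j ∉ S}, W i j.1 = (∑' j, W i j) - ∑ j ∈ S, W i j := by
  have hsum : Summable fun j => W i j := by
    refine summable_of_hasFiniteSupport ((hlocfin i).subset fun j hj => ?_)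
    exact lt_of_le_of_ne (hnonneg i j) (Ne.symm hj)
  have := hsum.sum_add_tsum_subtype_compl S
  linarith

lemma kcNuS_cons (W : Vinf → Vinf → ℝ) (hsymm : ∀ i j, W i j = W j i)
    (hnonneg : ∀ i j, 0 ≤ W i j)
    (hlocfin : ∀ i, {j : Vinf | 0 < W i j}.Finite) (S : Finset Vinf) (T : Finset Vinf)
    (hST : S ⊆ T) :
    Measure.map (fun p : ({i // i ∈ T} → ℝ) × ({i // i ∈ T} → ℝ) =>
      ((fun i : {i // i ∈ S} => p.1 ⟨i.1, hST i.2⟩), fun i : {i // i ∈ S} => p.2 ⟨i.1, hST i.2⟩))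
      (kcNuS W T) = kcNuS W S := by
  induction T using Finset.strongInduction with
  | H T ih =>
    by_cases hTS : T ⊆ S
    · obtain rfl : S = T := hST.antisymm hTS
      exact Measure.map_id
    · obtain ⟨v, hvT, hvS⟩ := Finset.not_subset.mp hTS
      have hsub : S ⊆ T.erase v := fun i hi =>
        Finset.mem_erase.mpr ⟨fun h => hvS (h ▸ hi), hST hi⟩
      have hih := ih (T.erase v) (Finset.erase_ssubset hvT) hsub
      let e : {i // i ∈ T.erase v} ⊕ Unit ≃ {i // i ∈ T} := Equiv.ofBijective
        (Sum.elim (fun i => ⟨i.1, Finset.mem_of_mem_erase i.2⟩) (fun _ => ⟨v, hvT⟩)) (by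
          constructor
          · rintro (i | i) (j | j) hij
            · simp only [Sum.elim_inl, Subtype.mk.injEq] at hij
              exact congrArg _ (Subtype.ext hij)
            · simp only [Sum.elim_inl, Sum.elim_inr, Subtype.mk.injEq] at hij
              exact absurd hij (Finset.ne_of_mem_erase i.2)
            · simp only [Sum.elim_inl, Sum.elim_inr, Subtype.mk.injEq] at hij
              exact absurd hij.symm (Finset.ne_of_mem_erase j.2)
            · rfl
          · rintro ⟨i, hi⟩
            by_cases h : i = v
            · exact ⟨.inr (), by simp [h]⟩
            · exact ⟨.inl ⟨i, Finset.mem_erase.mpr ⟨h, hi⟩⟩, rfl⟩)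
      have hone := kcNu_onestep e (fun i j => W i.1 j.1) (fun i j => hsymm _ _)
        (fun i j => hnonneg _ _) (fun i => ∑' j : {j : Vinf // j ∉ T}, W i.1 j.1)
        (fun i => tsum_nonneg fun j => hnonneg _ _)
      have heq : kcNu (fun i j => W (e (.inl i)).1 (e (.inl j)).1)
          (fun i => (∑' j : {j : Vinf // j ∉ T}, W (e (.inl i)).1 j.1)
            + W (e (.inl i)).1 (e (.inr ())).1) = kcNuS W (T.erase v) := by
        unfold kcNuS
        congr 1
        funext i
        have h1 : (e (.inl i)).1 = i.1 := rfl
        have h2 : (e (.inr ())).1 = v := rfl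
        rw [h1, h2, kc_eta W hnonneg hlocfin, kc_eta W hnonneg hlocfin,
          ← Finset.add_sum_erase T _ hvT]
        ring
      rw [heq] at hone
      rw [← hih, ← hone, Measure.map_map (by fun_prop) (by fun_prop)]
      rfl
end

section
variable {ι : Type*} [Fintype ι] [DecidableEq ι] (W : ι → ι → ℝ) (η : ι → ℝ)

/-- `β` as a function of `u`. -/
def kcb (u : ι → ℝ) (i : ι) : ℝ :=
  (1/2) * ((∑ j, W i j * Real.exp (u j - u i)) + η i * Real.exp (-u i))

/-- The matrix mapping `s` to `θ`. -/
def kcM (u : ι → ℝ) : Matrix ι ι ℝ :=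
  kcH W (kcb W η u) * Matrix.diagonal fun i => Real.exp (u i)

/-- Jacobian matrix of `β`. -/
def kcJ (u : ι → ℝ) : Matrix ι ι ℝ :=
  Matrix.diagonal (fun i => -(1/2) * Real.exp (-u i)) * kcM W η u

lemma kcH_mulVec_apply (hd : ∀ i, W i i = 0) (β x : ι → ℝ) (i : ι) :
    (kcH W β *ᵥ x) i = 2 * β i * x i - ∑ j, W i j * x j := by
  have : ∀ j, kcH W β i j * x j = (if i = j then 2 * β i * x j else 0) - W i j * x j := by
    intro j
    simp only [kcH, Matrix.of_apply]
    split_ifs with h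
    · subst h; rw [hd]; ring
    · ring
  simp only [Matrix.mulVec, dotProduct, this, Finset.sum_sub_distrib]
  simp

lemma kcH_exp (hd : ∀ i, W i i = 0) (u : ι → ℝ) :
    kcH W (kcb W η u) *ᵥ (fun i => Real.exp (u i)) = η := by
  ext i
  rw [kcH_mulVec_apply W hd]
  simp only [kcb]
  have h1 : ∀ j, W i j * Real.exp (u j - u i) * Real.exp (u i) = W i j * Real.exp (u j) := by
    intro j; rw [mul_assoc, ← Real.exp_add]; congr 2; ring
  have h2 : Real.exp (-u i) * Real.exp (u i) = 1 := by rw [← Real.exp_add]; simp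
  have h3 : (∑ j, W i j * Real.exp (u j - u i)) * Real.exp (u i)
      = ∑ j, W i j * Real.exp (u j) := by
    rw [Finset.sum_mul]; exact Finset.sum_congr rfl fun j _ => h1 j
  linear_combination h3 + η i * h2

lemma kcM_mulVec (u s : ι → ℝ) :
    kcM W η u *ᵥ s = kcH W (kcb W η u) *ᵥ (fun i => Real.exp (u i) * s i) := by
  rw [kcM, ← Matrix.mulVec_mulVec]
  congr 1
  ext i
  rw [Matrix.mulVec_diagonal]

lemma kcb_quad (hs : ∀ i j, W i j = W j i) (hd : ∀ i, W i i = 0) (u z : ι → ℝ) :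
    (fun i => Real.exp (u i) * z i) ⬝ᵥ
      (kcH W (kcb W η u) *ᵥ (fun i => Real.exp (u i) * z i))
    = (1/2) * ∑ i, ∑ j, W i j * Real.exp (u i) * Real.exp (u j) * (z i - z j)^2
      + ∑ i, η i * Real.exp (u i) * (z i)^2 := by
  have h0 : ∀ i, 2 * kcb W η u i * Real.exp (u i) = η i + ∑ j, W i j * Real.exp (u j) := by
    intro i
    have := congrFun (kcH_exp W η hd u) i
    rw [kcH_mulVec_apply W hd] at this
    linarith
  have h1 : ∀ i, (kcH W (kcb W η u) *ᵥ (fun i => Real.exp (u i) * z i)) i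
      = η i * z i + ∑ j, W i j * Real.exp (u j) * (z i - z j) := by
    intro i
    rw [kcH_mulVec_apply W hd]
    have : ∑ j, W i j * Real.exp (u j) * (z i - z j)
      = (∑ j, W i j * Real.exp (u j)) * z i - ∑ j, W i j * (Real.exp (u j) * z j) := by
      rw [Finset.sum_mul, ← Finset.sum_sub_distrib]
      exact Finset.sum_congr rfl fun j _ => by ring
    rw [this]
    linear_combination z i * h0 i
  simp only [dotProduct, h1, mul_add, Finset.mul_sum, Finset.sum_add_distrib]
  have h2 : ∑ i, ∑ j, Real.exp (u i) * z i * (W i j * Real.exp (u j) * (z i - z j))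
      = ∑ i, ∑ j, Real.exp (u i) * z j * (W i j * Real.exp (u j) * (z j - z i)) := by
    rw [Finset.sum_comm]
    refine Finset.sum_congr rfl fun i _ => Finset.sum_congr rfl fun j _ => ?_
    rw [hs j i]; ring
  have h3 : ∑ i, ∑ j, 1/2 * (W i j * Real.exp (u i) * Real.exp (u j) * (z i - z j)^2)
      = 1/2 * (∑ i, ∑ j, Real.exp (u i) * z i * (W i j * Real.exp (u j) * (z i - z j))
      + ∑ i, ∑ j, Real.exp (u i) * z j * (W i j * Real.exp (u j) * (z j - z i))) := by
    rw [← Finset.sum_add_distrib, Finset.mul_sum]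
    refine Finset.sum_congr rfl fun i _ => ?_
    rw [← Finset.sum_add_distrib, Finset.mul_sum]
    refine Finset.sum_congr rfl fun j _ => ?_
    ring
  rw [h3, ← h2]
  have h4 : ∑ i, Real.exp (u i) * z i * (η i * z i) = ∑ i, η i * Real.exp (u i) * z i ^ 2 :=
    Finset.sum_congr rfl fun i _ => by ring
  rw [h4]; ring

/-- Reachability from the boundary. -/
def kcReach : Prop := ∀ P : ι → Prop, (∀ i, 0 < η i → P i) →
  (∀ i j, 0 < W i j → P j → P i) → ∀ i, P i


lemma kcb_posDef (hs : ∀ i j, W i j = W j i) (hd : ∀ i, W i i = 0) (hW : ∀ i j, 0 ≤ W i j)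
  (hη : ∀ i, 0 ≤ η i) (hr : kcReach W η) (u : ι → ℝ) : (kcH W (kcb W η u)).PosDef := by
  refine Matrix.PosDef.of_dotProduct_mulVec_pos (kcH_symm W hs _) fun x hx => ?_
  obtain ⟨z, rfl⟩ : ∃ z : ι → ℝ, x = fun i => Real.exp (u i) * z i :=
    ⟨fun i => Real.exp (-u i) * x i, by
      ext i; rw [← mul_assoc, ← Real.exp_add]; simp⟩
  rw [star_trivial, kcb_quad W η hs hd]
  have e1 : ∀ i j, 0 ≤ W i j * Real.exp (u i) * Real.exp (u j) * (z i - z j)^2 :=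
    fun i j => by have := hW i j; positivity
  have e2 : ∀ i, 0 ≤ η i * Real.exp (u i) * (z i)^2 := fun i => by
    have := hη i; positivity
  have e3 : 0 ≤ ∑ i, ∑ j, W i j * Real.exp (u i) * Real.exp (u j) * (z i - z j)^2 :=
    Finset.sum_nonneg fun i _ => Finset.sum_nonneg fun j _ => e1 i j
  have e4 : 0 ≤ ∑ i, η i * Real.exp (u i) * (z i)^2 := Finset.sum_nonneg fun i _ => e2 i
  by_contra hcon
  have f1 : ∑ i, ∑ j, W i j * Real.exp (u i) * Real.exp (u j) * (z i - z j)^2 = 0 := by linarith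
  have f2 : ∑ i, η i * Real.exp (u i) * (z i)^2 = 0 := by linarith
  rw [Finset.sum_eq_zero_iff_of_nonneg fun i _ => e2 i] at f2
  rw [Finset.sum_eq_zero_iff_of_nonneg fun i _ => Finset.sum_nonneg fun j _ => e1 i j] at f1
  apply hx
  ext i
  have : z i = 0 := by
    refine hr (fun i => z i = 0) ?_ ?_ i
    · intro i hi
      have := f2 i (Finset.mem_univ i)
      have hp := Real.exp_pos (u i)
      simpa [hi.ne', hp.ne'] using this
    · intro i j hij hj
      have := f1 i (Finset.mem_univ i)
      rw [Finset.sum_eq_zero_iff_of_nonneg fun j _ => e1 i j] at this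
      have := this j (Finset.mem_univ j)
      have hp := Real.exp_pos (u i)
      have hp' := Real.exp_pos (u j)
      have : z i - z j = 0 := by simpa [hij.ne', hp.ne', hp'.ne'] using this
      linarith
  simp [this]

lemma kcb_inj (hs : ∀ i j, W i j = W j i) (hd : ∀ i, W i i = 0) (hW : ∀ i j, 0 ≤ W i j)
  (hη : ∀ i, 0 ≤ η i) (hr : kcReach W η) : Function.Injective (kcb W η) := by
  intro u v huv
  have h1 := kc_inv_mulVec _ (kcb_posDef W η hs hd hW hη hr u) _ _ (kcH_exp W η hd u)
  have h2 := kc_inv_mulVec _ (kcb_posDef W η hs hd hW hη hr v) _ _ (kcH_exp W η hd v)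
  rw [huv, h2] at h1
  ext i
  exact (Real.exp_injective (congrFun h1 i)).symm

lemma kcb_image (hs : ∀ i j, W i j = W j i) (hd : ∀ i, W i i = 0) (hW : ∀ i j, 0 ≤ W i j)
  (hη : ∀ i, 0 ≤ η i) (hr : kcReach W η) : kcb W η '' Set.univ = {β | (kcH W β).PosDef} := by
  ext β
  simp only [Set.image_univ, Set.mem_range, Set.mem_ofPred_eq]
  constructor
  · rintro ⟨u, rfl⟩
    exact kcb_posDef W η hs hd hW hη hr u
  intro hP
  set x := (kcH W β)⁻¹ *ᵥ η with hx
  have hHx : kcH W β *ᵥ x = η := kc_mulVec_inv _ hP η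
  have hx0 : ∀ i, 0 ≤ x i := kc_Mmatrix W hW β hP x (fun i => by rw [hHx]; exact hη i)
  have hβ : ∀ i, 0 < β i := fun i => by
    have := hP.diag_pos (i := i)
    simp [kcH] at this
    exact this
  have heq : ∀ i, 2 * β i * x i = η i + ∑ j, W i j * x j := fun i => by
    have := congrFun hHx i
    rw [kcH_mulVec_apply W hd] at this
    linarith
  have hnn : ∀ i, 0 ≤ ∑ j, W i j * x j := fun i =>
    Finset.sum_nonneg fun j _ => mul_nonneg (hW i j) (hx0 j)
  have hxp : ∀ i, 0 < x i := by
    refine hr (fun i => 0 < x i) ?_ ?_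
    · intro i hi
      have h1 : 0 < 2 * β i * x i := by rw [heq]; have := hnn i; linarith
      exact pos_of_mul_pos_right h1 (by have := hβ i; positivity)
    · intro i j hij hj
      have h2 : W i j * x j ≤ ∑ j, W i j * x j :=
        Finset.single_le_sum (f := fun j => W i j * x j)
          (fun j _ => mul_nonneg (hW i j) (hx0 j)) (Finset.mem_univ j)
      have h3 : 0 < W i j * x j := mul_pos hij hj
      have h1 : 0 < 2 * β i * x i := by rw [heq]; have := hη i; linarith
      exact pos_of_mul_pos_right h1 (by have := hβ i; positivity)
  refine ⟨fun i => Real.log (x i), ?_⟩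
  ext i
  simp only [kcb]
  have h4 : ∀ j, Real.exp (Real.log (x j) - Real.log (x i)) = x j / x i := fun j => by
    rw [Real.exp_sub, Real.exp_log (hxp j), Real.exp_log (hxp i)]
  have h5 : Real.exp (-Real.log (x i)) = (x i)⁻¹ := by
    rw [Real.exp_neg, Real.exp_log (hxp i)]
  simp only [h4, h5]
  have h6 : ∑ j, W i j * (x j / x i) = (∑ j, W i j * x j) / x i := by
    rw [Finset.sum_div]; exact Finset.sum_congr rfl fun j _ => by ring
  rw [h6]
  have := heq i
  have hxi := (hxp i).ne'
  field_simp
  linarith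

lemma kcJ_mulVec (hd : ∀ i, W i i = 0) (u v : ι → ℝ) (i : ι) :
    (kcJ W η u *ᵥ v) i = (1/2) * ((∑ j, W i j * (Real.exp (u j - u i) * (v j - v i)))
      + η i * (Real.exp (-u i) * (-v i))) := by
  rw [kcJ, ← Matrix.mulVec_mulVec, Matrix.mulVec_diagonal, kcM_mulVec, kcH_mulVec_apply W hd]
  simp only [kcb]
  have h2 : Real.exp (-u i) * Real.exp (u i) = 1 := by rw [← Real.exp_add]; simp
  have h3 : ∑ j, W i j * (Real.exp (u j - u i) * (v j - v i))
    = Real.exp (-u i) * (∑ j, W i j * (Real.exp (u j) * v j))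
      - (∑ j, W i j * Real.exp (u j - u i)) * v i := by
    rw [Finset.mul_sum, Finset.sum_mul, ← Finset.sum_sub_distrib]
    refine Finset.sum_congr rfl fun j _ => ?_
    rw [sub_eq_add_neg (u j), Real.exp_add]; ring
  rw [h3]
  linear_combination (-(1/2) * v i * (∑ j, W i j * Real.exp (u j - u i))
    -(1/2) * v i * η i * Real.exp (-u i)) * h2

lemma kcb_hasFDerivAt (hd : ∀ i, W i i = 0) (u : ι → ℝ) :
    HasFDerivAt (kcb W η) (LinearMap.toContinuousLinearMap (Matrix.toLin' (kcJ W η u))) u := by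
  rw [hasFDerivAt_pi']
  intro i
  have hp : ∀ j, HasFDerivAt (fun u : ι → ℝ => u j) (ContinuousLinearMap.proj (R := ℝ) j) u :=
    fun j => hasFDerivAt_apply j u
  have h1 : HasFDerivAt (fun u : ι → ℝ => ∑ j, W i j * Real.exp (u j - u i)) _ u :=
    HasFDerivAt.fun_sum (u := Finset.univ) fun j _ =>
      (((hp j).fun_sub (hp i)).exp).const_mul (W i j)
  have h2 := ((hp i).fun_neg.exp).const_mul (η i)
  have h3 := (h1.fun_add h2).const_mul (1/2)
  refine h3.congr_fderiv ?_
  ext v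
  have := kcJ_mulVec W η hd u v i
  simp [this]
  ring

lemma kcM_det (u : ι → ℝ) :
    (kcM W η u).det = (kcH W (kcb W η u)).det * ∏ i, Real.exp (u i) := by
  rw [kcM, Matrix.det_mul, Matrix.det_diagonal]

lemma kcJ_det (u : ι → ℝ) :
    (kcJ W η u).det = (-(1/2))^Fintype.card ι * (kcH W (kcb W η u)).det := by
  rw [kcJ, Matrix.det_mul, kcM_det, Matrix.det_diagonal, Finset.prod_mul_distrib]
  simp only [Finset.prod_const, Finset.card_univ]
  have : (∏ i, Real.exp (-u i)) * ∏ i, Real.exp (u i) = 1 := by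
    rw [← Finset.prod_mul_distrib]
    refine Finset.prod_eq_one fun i _ => ?_
    rw [← Real.exp_add]; simp
  linear_combination (-(1/2))^Fintype.card ι * (kcH W (kcb W η u)).det * this

end

section
variable {ι : Type*} [Fintype ι] [DecidableEq ι] (W : ι → ι → ℝ) (η : ι → ℝ)

lemma kc_lin_cov (M : Matrix ι ι ℝ) (hM : M.det ≠ 0) (g : (ι → ℝ) → ENNReal) :
    ∫⁻ s, ENNReal.ofReal |M.det| * g (M *ᵥ s) = ∫⁻ θ, g θ := by
  have hinj : Function.Injective fun s => M *ᵥ s := by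
    intro s t hst
    have := congrArg (fun x => M⁻¹ *ᵥ x) hst
    simpa [Matrix.mulVec_mulVec, Matrix.nonsing_inv_mul M (isUnit_iff_ne_zero.mpr hM)] using this
  have himg : (fun s => M *ᵥ s) '' Set.univ = Set.univ := by
    rw [Set.image_univ, Set.range_eq_univ]
    intro t
    refine ⟨M⁻¹ *ᵥ t, ?_⟩
    simp [Matrix.mulVec_mulVec, Matrix.mul_nonsing_inv M (isUnit_iff_ne_zero.mpr hM)]
  have := lintegral_image_eq_lintegral_abs_det_fderiv_mul (volume : Measure (ι → ℝ))
    MeasurableSet.univ (f := fun s => M *ᵥ s)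
    (f' := fun _ => LinearMap.toContinuousLinearMap (Matrix.toLin' M))
    (fun x _ => (LinearMap.toContinuousLinearMap (Matrix.toLin' M)).hasFDerivAt.hasFDerivWithinAt)
    hinj.injOn g
  rw [himg, Measure.restrict_univ] at this
  rw [this]
  refine lintegral_congr fun s => ?_
  rw [ContinuousLinearMap.det, LinearMap.coe_toContinuousLinearMap, LinearMap.det_toLin']

lemma kc_cov (hs : ∀ i j, W i j = W j i) (hd : ∀ i, W i i = 0) (hW : ∀ i j, 0 ≤ W i j)
    (hη : ∀ i, 0 ≤ η i) (hr : kcReach W η)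
    (h : (ι → ℝ) × (ι → ℝ) → ENNReal) (hh : Measurable h) :
    ∫⁻ u, ∫⁻ s, ENNReal.ofReal (|(kcJ W η u).det| * |(kcM W η u).det|
        * kcR W η (kcb W η u) (kcM W η u *ᵥ s)) * h (kcb W η u, kcM W η u *ᵥ s)
      = ∫⁻ p, h p ∂(kcNu W η) := by
  rw [kc_lint_nu W η h hh]
  have h1 : ∀ u, ∫⁻ s, ENNReal.ofReal (|(kcJ W η u).det| * |(kcM W η u).det|
        * kcR W η (kcb W η u) (kcM W η u *ᵥ s)) * h (kcb W η u, kcM W η u *ᵥ s)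
      = ENNReal.ofReal |(kcJ W η u).det| *
        ∫⁻ θ, ENNReal.ofReal (kcR W η (kcb W η u) θ) * h (kcb W η u, θ) := by
    intro u
    have hdet : (kcM W η u).det ≠ 0 := by
      rw [kcM_det]
      have := (kcb_posDef W η hs hd hW hη hr u).det_pos
      have h2 : 0 < ∏ i, Real.exp (u i) := Finset.prod_pos fun i _ => Real.exp_pos _
      positivity
    rw [← kc_lin_cov (kcM W η u) hdet
      (fun θ => ENNReal.ofReal (kcR W η (kcb W η u) θ) * h (kcb W η u, θ)), ← lintegral_const_mul' _ _ ENNReal.ofReal_ne_top]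
    refine lintegral_congr fun s => ?_
    rw [ENNReal.ofReal_mul (by positivity), ENNReal.ofReal_mul (by positivity)]
    ring
  simp only [h1]
  have h2 := lintegral_image_eq_lintegral_abs_det_fderiv_mul (volume : Measure (ι → ℝ))
    MeasurableSet.univ (f := kcb W η)
    (f' := fun u => LinearMap.toContinuousLinearMap (Matrix.toLin' (kcJ W η u)))
    (fun x _ => (kcb_hasFDerivAt W η hd x).hasFDerivWithinAt)
    (kcb_inj W η hs hd hW hη hr).injOn
    (fun β => ∫⁻ θ, ENNReal.ofReal (kcR W η β θ) * h (β, θ))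
  rw [Measure.restrict_univ, kcb_image W η hs hd hW hη hr] at h2
  simp only [ContinuousLinearMap.det, LinearMap.coe_toContinuousLinearMap,
    LinearMap.det_toLin'] at h2
  rw [← h2, ← lintegral_indicator (kcH_posDef_meas W)]
  refine lintegral_congr fun β => ?_
  by_cases hP : (kcH W β).PosDef
  · rw [Set.indicator_of_mem (by exact hP)]
    simp only [kcD, if_pos hP]
  · rw [Set.indicator_of_notMem (by exact hP)]
    simp only [kcD, if_neg hP, zero_mul, lintegral_zero]

/-- Value of the exponent. -/
lemma kc_density (hs : ∀ i j, W i j = W j i) (hd : ∀ i, W i i = 0) (hW : ∀ i j, 0 ≤ W i j)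
    (hη : ∀ i, 0 ≤ η i) (hr : kcReach W η) (u s : ι → ℝ) :
    |(kcJ W η u).det| * |(kcM W η u).det| * kcR W η (kcb W η u) (kcM W η u *ᵥ s)
    = Real.exp (-(1/2) * ((1/2) * ∑ i, ∑ j, W i j * Real.exp (u i) * Real.exp (u j)
          * (s i - s j)^2 + ∑ i, η i * Real.exp (u i) * (s i)^2))
      * ((kcH W (kcb W η u)).det * (∏ i, Real.exp (u i))^2)
      * Real.exp (-((1/2) * ∑ i, ∑ j, W i j * (Real.cosh (u i - u j) - 1)
          + ∑ i, η i * (Real.cosh (u i) - 1)))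
      * ∏ i, (Real.exp (-u i) / (2 * Real.pi)) := by
  have hP := kcb_posDef W η hs hd hW hη hr u
  have hdp := hP.det_pos
  have hprod : 0 < ∏ i, Real.exp (u i) := Finset.prod_pos fun i _ => Real.exp_pos _
  have hinv : (∏ i, Real.exp (-u i)) = (∏ i, Real.exp (u i))⁻¹ := by
    rw [← Finset.prod_inv_distrib]
    exact Finset.prod_congr rfl fun i _ => Real.exp_neg _
  rw [kcJ_det, kcM_det, abs_mul, abs_of_pos hdp, abs_of_pos (mul_pos hdp hprod), abs_pow,
    abs_neg, abs_of_pos (by norm_num : (0:ℝ) < 1/2), kcR, kcM_mulVec,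
    kc_inv_mulVec _ hP _ _ rfl, kc_inv_mulVec _ hP _ _ (kcH_exp W η hd u), dotProduct_comm _ (fun i => Real.exp (u i) * s i),
    kcb_quad W η hs hd, Finset.prod_div_distrib, hinv, Finset.prod_const, Finset.card_univ,
    mul_pow]
  have hexp : ((∑ i, ∑ j, kcH W (kcb W η u) i j) + η ⬝ᵥ (fun i => Real.exp (u i)))
      = 2 * ((1/2) * ∑ i, ∑ j, W i j * (Real.cosh (u i - u j) - 1)
          + ∑ i, η i * (Real.cosh (u i) - 1)) + 2 * ∑ i, η i := by
    have a1 : ∀ i, ∑ j, kcH W (kcb W η u) i j = 2 * kcb W η u i - ∑ j, W i j := by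
      intro i
      have := kcH_mulVec_apply W hd (kcb W η u) (fun _ => 1) i
      simpa [Matrix.mulVec, dotProduct] using this
    have a2 : ∑ i, ∑ j, W i j * (Real.exp (u j - u i) - 1)
        = ∑ i, ∑ j, W i j * (Real.cosh (u i - u j) - 1) := by
      have b1 : ∑ i, ∑ j, W i j * (Real.exp (u j - u i) - 1)
        = ∑ i, ∑ j, W i j * (Real.exp (u i - u j) - 1) := by
        rw [Finset.sum_comm]
        refine Finset.sum_congr rfl fun i _ => Finset.sum_congr rfl fun j _ => ?_
        rw [hs j i]
      have b2 : ∑ i, ∑ j, W i j * (Real.cosh (u i - u j) - 1)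
        = (1/2) * (∑ i, ∑ j, W i j * (Real.exp (u j - u i) - 1)
          + ∑ i, ∑ j, W i j * (Real.exp (u i - u j) - 1)) := by
        rw [← Finset.sum_add_distrib, Finset.mul_sum]
        refine Finset.sum_congr rfl fun i _ => ?_
        rw [← Finset.sum_add_distrib, Finset.mul_sum]
        refine Finset.sum_congr rfl fun j _ => ?_
        rw [Real.cosh_eq, neg_sub]; ring
      rw [b2, ← b1]; ring
    simp only [a1, dotProduct]
    rw [← a2]
    simp only [Finset.mul_sum, ← Finset.sum_add_distrib, kcb]
    refine Finset.sum_congr rfl fun i _ => ?_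
    simp only [mul_sub, Finset.sum_sub_distrib, ← Finset.mul_sum, Real.cosh_eq]
    generalize (∑ x, W i x * Real.exp (u x - u i)) = S
    ring
  have key : ∀ q : ℝ, Real.exp (-(1/2) * ((∑ i, ∑ j, kcH W (kcb W η u) i j)
      + η ⬝ᵥ (fun i => Real.exp (u i)) + q) + ∑ i, η i)
      = Real.exp (-(1/2) * q) * Real.exp (-((1/2) * ∑ i, ∑ j, W i j * (Real.cosh (u i - u j) - 1)
          + ∑ i, η i * (Real.cosh (u i) - 1))) := by
    intro q
    rw [hexp, ← Real.exp_add]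
    congr 1; ring
  rw [key]
  have hpi := Real.pi_pos
  rw [div_pow, one_pow]
  field_simp

end

section
variable {V : Type*} [Fintype V] [DecidableEq V] (δ : V) (W : V → V → ℝ)

lemma kc_split (f : V → ℝ) : ∑ i, f i = f δ + ∑ i : {i // i ≠ δ}, f i.1 :=
  Fintype.sum_eq_add_sum_subtype_ne f δ

lemma kc_ext_self (x : {i // i ≠ δ} → ℝ) : extendByZero δ x δ = 0 := by simp [extendByZero]

lemma kc_ext_coe (x : {i // i ≠ δ} → ℝ) (i : {i // i ≠ δ}) : extendByZero δ x i.1 = x i := by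
  simp [extendByZero, i.2]

lemma kc_ext_meas : Measurable (extendByZero δ : ({i // i ≠ δ} → ℝ) → V → ℝ) := by
  refine measurable_pi_lambda _ fun i => ?_
  by_cases h : i = δ
  · simp [extendByZero, h]
  · simp only [extendByZero, h, dif_neg, not_false_eq_true]
    exact measurable_pi_apply _

/-- restricted weights -/
abbrev kcWi : {i // i ≠ δ} → {i // i ≠ δ} → ℝ := fun i j => W i.1 j.1
/-- boundary weights -/
abbrev kcEi : {i // i ≠ δ} → ℝ := fun i => W i.1 δ

lemma kc_beta_eq (u : {i // i ≠ δ} → ℝ) (i : {i // i ≠ δ}) :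
    betaW W (extendByZero δ u) i.1 = kcb (kcWi δ W) (kcEi δ W) u i := by
  simp only [betaW, kcb, kc_split δ, kc_ext_self, kc_ext_coe, zero_sub]
  ring

lemma kc_theta_eq (hd : ∀ i, W i i = 0) (u s : {i // i ≠ δ} → ℝ) (i : {i // i ≠ δ}) :
    thetaW W (extendByZero δ u) (extendByZero δ s) i.1
      = (kcM (kcWi δ W) (kcEi δ W) u *ᵥ s) i := by
  have h0 := congrFun (kcH_exp (kcWi δ W) (kcEi δ W) (fun i => hd i.1) u) i
  rw [kcH_mulVec_apply _ (fun i => hd i.1)] at h0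
  rw [kcM_mulVec, kcH_mulVec_apply _ (fun i => hd i.1)]
  simp only [thetaW, kc_split δ, kc_ext_self, kc_ext_coe, Real.exp_zero, mul_sub,
    Finset.sum_sub_distrib, ← Finset.sum_mul, mul_assoc] at h0 ⊢
  simp only [← mul_assoc, ← Finset.sum_mul] at h0 ⊢
  linear_combination - s i * h0

lemma kc_AVV_eq (hd : ∀ i, W i i = 0) (u : {i // i ≠ δ} → ℝ) :
    AVV W δ (extendByZero δ u) = Matrix.diagonal (fun i => Real.exp (u i)) *
      kcH (kcWi δ W) (kcb (kcWi δ W) (kcEi δ W) u) * Matrix.diagonal (fun i => Real.exp (u i)) := by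
  ext i j
  rw [Matrix.mul_diagonal, Matrix.diagonal_mul]
  simp only [AVV, Amat, Matrix.of_apply, kcH, kc_ext_coe]
  by_cases h : i = j
  · subst h
    have h0 := congrFun (kcH_exp (kcWi δ W) (kcEi δ W) (fun i => hd i.1) u) i
    rw [kcH_mulVec_apply _ (fun i => hd i.1)] at h0
    simp only [if_true, kc_split δ, kc_ext_self, kc_ext_coe, Real.exp_add, Real.exp_zero]
    have : ∑ k : {i // i ≠ δ}, W i.1 k.1 * (Real.exp (u i) * Real.exp (u k))
      = Real.exp (u i) * ∑ k : {i // i ≠ δ}, W i.1 k.1 * Real.exp (u k) := by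
      rw [Finset.mul_sum]; exact Finset.sum_congr rfl fun k _ => by ring
    rw [this]
    linear_combination - Real.exp (u i) * h0
  · have h' : i.1 ≠ j.1 := fun hh => h (Subtype.ext hh)
    simp only [h, h', if_false, Real.exp_add]
    ring

lemma kc_rho_eq (hs : ∀ i j, W i j = W j i) (hd : ∀ i, W i i = 0) (u s : {i // i ≠ δ} → ℝ) :
    rhoW W δ (extendByZero δ u) (extendByZero δ s)
    = Real.exp (-(1/2) * ((1/2) * ∑ i, ∑ j, kcWi δ W i j * Real.exp (u i) * Real.exp (u j)
          * (s i - s j)^2 + ∑ i, kcEi δ W i * Real.exp (u i) * (s i)^2))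
      * ((kcH (kcWi δ W) (kcb (kcWi δ W) (kcEi δ W) u)).det * (∏ i, Real.exp (u i))^2)
      * Real.exp (-((1/2) * ∑ i, ∑ j, kcWi δ W i j * (Real.cosh (u i - u j) - 1)
          + ∑ i, kcEi δ W i * (Real.cosh (u i) - 1))) := by
  have hA := kc_AVV_eq δ W hd u
  have hq : ∑ i, ∑ j, extendByZero δ s i * Amat W (extendByZero δ u) i j * extendByZero δ s j
      = (fun i => Real.exp (u i) * s i) ⬝ᵥ (kcH (kcWi δ W) (kcb (kcWi δ W) (kcEi δ W) u)
        *ᵥ (fun i => Real.exp (u i) * s i)) := by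
    simp only [kc_split δ, kc_ext_self, kc_ext_coe, zero_mul, mul_zero, Finset.sum_const_zero,
      zero_add, dotProduct, Matrix.mulVec, Finset.mul_sum]
    refine Finset.sum_congr rfl fun i _ => Finset.sum_congr rfl fun j _ => ?_
    have := congrFun (congrFun hA i) j
    rw [Matrix.mul_diagonal, Matrix.diagonal_mul] at this
    simp only [AVV, Matrix.of_apply] at this
    rw [this]; ring
  rw [rhoW, hq, kcb_quad _ _ (fun i j => hs i.1 j.1) (fun i => hd i.1), hA, Matrix.det_mul,
    Matrix.det_mul, Matrix.det_diagonal]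
  have hc : (1/2) * ∑ i, ∑ j, W i j * (Real.cosh (extendByZero δ u i - extendByZero δ u j) - 1)
      = (1/2) * ∑ i, ∑ j, kcWi δ W i j * (Real.cosh (u i - u j) - 1)
          + ∑ i, kcEi δ W i * (Real.cosh (u i) - 1) := by
    simp only [kc_split δ, kc_ext_self, kc_ext_coe, zero_sub, sub_zero, Real.cosh_neg,
      Finset.sum_add_distrib, hd, zero_mul, zero_add]
    have : ∑ j : {i // i ≠ δ}, W δ j.1 * (Real.cosh (u j) - 1)
      = ∑ j : {i // i ≠ δ}, W j.1 δ * (Real.cosh (u j) - 1) :=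
      Finset.sum_congr rfl fun j _ => by rw [hs]
    rw [this]; ring
  rw [hc]
  ring

lemma kc_reach (hs : ∀ i j, W i j = W j i)
    (hc : (SimpleGraph.fromRel fun i j : V => 0 < W i j).Connected) :
    kcReach (kcWi δ W) (kcEi δ W) := by
  intro P h1 h2 i
  have key : ∀ v : V, ∀ w : (SimpleGraph.fromRel fun i j : V => 0 < W i j).Walk v δ,
      ∀ hv : v ≠ δ, P ⟨v, hv⟩ := by
    intro v w
    induction w with
    | nil => intro hv; exact absurd rfl hv
    | @cons a b c hab _ ih =>
      intro hv
      have hpos : 0 < W a b := by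
        rw [SimpleGraph.fromRel_adj] at hab
        rcases hab.2 with h | h
        · exact h
        · rw [hs]; exact h
      by_cases hb : b = c
      · subst hb; exact h1 ⟨a, hv⟩ hpos
      · exact h2 ⟨a, hv⟩ ⟨b, hb⟩ hpos (ih P h1 h2 i hb)
  obtain ⟨w⟩ := hc.preconnected i.1 δ
  exact key i.1 w i.2

lemma kc_beta_meas : Measurable fun p : (V → ℝ) × (V → ℝ) => fun i : V => betaW W p.1 i := by
  unfold betaW; fun_prop

lemma kc_theta_meas : Measurable fun p : (V → ℝ) × (V → ℝ) => fun i : V => thetaW W p.1 p.2 i := by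
  unfold thetaW; fun_prop

lemma kc_Amat_cont : Continuous fun u : V → ℝ => Amat W u := by
  refine continuous_matrix fun i j => ?_
  simp only [Amat, Matrix.of_apply]
  split_ifs <;> fun_prop

lemma kc_rho_meas : Measurable fun p : (V → ℝ) × (V → ℝ) => rhoW W δ p.1 p.2 := by
  have h1 : ∀ i j, Continuous fun p : (V → ℝ) × (V → ℝ) => Amat W p.1 i j := fun i j =>
    ((kc_Amat_cont W).matrix_elem i j).comp continuous_fst
  have h2 : Continuous fun p : (V → ℝ) × (V → ℝ) => (AVV W δ p.1).det := by
    refine Continuous.matrix_det (continuous_matrix fun i j => ?_)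
    exact h1 i.1 j.1
  have h3 : Continuous fun p : (V → ℝ) × (V → ℝ) => rhoW W δ p.1 p.2 := by
    unfold rhoW
    have := h1
    fun_prop
  exact h3.measurable

lemma kc_law (hs : ∀ i j, W i j = W j i) (hd : ∀ i, W i i = 0) (hW : ∀ i j, 0 ≤ W i j)
    (hc : (SimpleGraph.fromRel fun i j : V => 0 < W i j).Connected) :
    Measure.map (fun p : (V → ℝ) × (V → ℝ) => ((fun i : {i // i ≠ δ} => betaW W p.1 i.1),
      fun i : {i // i ≠ δ} => thetaW W p.1 p.2 i.1)) (muW W δ)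
    = kcNu (kcWi δ W) (kcEi δ W) := by
  have hb := kc_beta_meas W
  have ht := kc_theta_meas W
  have hmap : Measurable (fun p : (V → ℝ) × (V → ℝ) => ((fun i : {i // i ≠ δ} => betaW W p.1 i.1),
      fun i : {i // i ≠ δ} => thetaW W p.1 p.2 i.1)) := by
    refine Measurable.prodMk ?_ ?_
    · exact measurable_pi_lambda _ fun i => (measurable_pi_apply i.1).comp hb
    · exact measurable_pi_lambda _ fun i => (measurable_pi_apply i.1).comp ht
  have hrho := kc_rho_meas δ W
  have hdens : Measurable fun p : (V → ℝ) × (V → ℝ) => ENNReal.ofReal (rhoW W δ p.1 p.2 *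
      ∏ i : {i : V // i ≠ δ}, Real.exp (-(p.1 i.1)) / (2 * Real.pi)) := by
    refine ENNReal.measurable_ofReal.comp (hrho.mul ?_)
    fun_prop
  have hext : Measurable (fun p : ({i : V // i ≠ δ} → ℝ) × ({i : V // i ≠ δ} → ℝ) =>
      (extendByZero δ p.1, extendByZero δ p.2)) :=
    ((kc_ext_meas δ).comp measurable_fst).prodMk ((kc_ext_meas δ).comp measurable_snd)
  refine Measure.ext_of_lintegral _ fun h hh => ?_
  have hhm : Measurable fun p : (V → ℝ) × (V → ℝ) => h ((fun i : {i // i ≠ δ} => betaW W p.1 i.1),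
      fun i : {i // i ≠ δ} => thetaW W p.1 p.2 i.1) := hh.comp hmap
  rw [lintegral_map hh hmap, muW, lintegral_withDensity_eq_lintegral_mul _ hdens hhm,
    baseMeasure, lintegral_map (hdens.mul hhm) hext, Measure.volume_eq_prod]
  refine (lintegral_prod _ ((hdens.mul hhm).comp hext).aemeasurable).trans ?_
  rw [← kc_cov (kcWi δ W) (kcEi δ W) (fun i j => hs i.1 j.1) (fun i => hd i.1)
    (fun i j => hW i.1 j.1) (fun i => hW i.1 δ) (kc_reach δ W hs hc) h hh]
  refine lintegral_congr fun u => lintegral_congr fun s => ?_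
  rw [kc_density (kcWi δ W) (kcEi δ W) (fun i j => hs i.1 j.1) (fun i => hd i.1)
    (fun i j => hW i.1 j.1) (fun i => hW i.1 δ) (kc_reach δ W hs hc)]
  simp only [Pi.mul_apply, Function.comp_apply, kc_rho_eq δ W hs hd, kc_ext_coe, kc_beta_eq,
    kc_theta_eq δ W hd]

end

section
variable {Vinf : Type*} [DecidableEq Vinf]

/-- Identification of the non-boundary vertices. -/
def kcE (S : Finset Vinf) : {i // i ∈ S} ≃ {i : Option {i // i ∈ S} // i ≠ none} where
  toFun i := ⟨some i, by simp⟩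
  invFun i := i.1.get (Option.isSome_iff_ne_none.mpr i.2)
  left_inv i := by simp
  right_inv i := by ext; simp

lemma kc_law_S (W : Vinf → Vinf → ℝ) (hsymm : ∀ i j, W i j = W j i) (hdiag : ∀ i, W i i = 0)
    (hnonneg : ∀ i j, 0 ≤ W i j) (S : Finset Vinf)
    (hc : (SimpleGraph.fromRel
      fun i j : Option {i : Vinf // i ∈ S} => 0 < wiredW W S i j).Connected) :
    Measure.map
        (fun p : (Option {i // i ∈ S} → ℝ) × (Option {i // i ∈ S} → ℝ) =>
          ((fun j : {j : Vinf // j ∈ S} => betaW (wiredW W S) p.1 (some j)),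
          (fun j : {j : Vinf // j ∈ S} => thetaW (wiredW W S) p.1 p.2 (some j))))
        (muW (wiredW W S) none) = kcNuS W S := by
  have hs : ∀ i j, wiredW W S i j = wiredW W S j i := by
    rintro (_ | i) (_ | j) <;> simp only [wiredW]
    exact hsymm _ _
  have hd : ∀ i, wiredW W S i i = 0 := by
    rintro (_ | i) <;> simp only [wiredW]
    exact hdiag _
  have hW : ∀ i j, 0 ≤ wiredW W S i j := by
    rintro (_ | i) (_ | j) <;> simp only [wiredW]
    · exact le_rfl
    · exact tsum_nonneg fun _ => hnonneg _ _
    · exact tsum_nonneg fun _ => hnonneg _ _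
    · exact hnonneg _ _
  have h1 := kc_law none (wiredW W S) hs hd hW hc
  have h2 := kcNu_reindex (kcE S) (kcWi none (wiredW W S)) (kcEi none (wiredW W S))
  have hb := kc_beta_meas (wiredW W S)
  have ht := kc_theta_meas (wiredW W S)
  rw [← h1, Measure.map_map (by fun_prop) ?_] at h2
  · exact h2
  · refine Measurable.prodMk ?_ ?_
    · exact measurable_pi_lambda _ fun i => (measurable_pi_apply i.1).comp hb
    · exact measurable_pi_lambda _ fun i => (measurable_pi_apply i.1).comp ht

end

end kcHelpers

/-- Kolmogorov consistency: with `V_n ⊆ V_{n+1}` finite subsets of the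
infinite, connected, locally finite weighted graph `G_∞`, and `a, b` with `a_i = 1`,
`b_i = 0` on `Ṽ_{n+1}∖V_n`, the Laplace-transform consistency identity holds, and
consequently the joint law of `(β^{V_n},θ^{V_n})` under `μ^W_n` agrees with the law of
`((β^{V_{n+1}}_i)_{i∈V_n},(θ^{V_{n+1}}_i)_{i∈V_n})` under `μ^W_{n+1}`. -/
theorem stmt2 {Vinf : Type*} [DecidableEq Vinf] [Infinite Vinf]
    (W : Vinf → Vinf → ℝ)
    (hsymm : ∀ i j, W i j = W j i)
    (hdiag : ∀ i, W i i = 0)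
    (hnonneg : ∀ i j, 0 ≤ W i j)
    (hlocfin : ∀ i, {j : Vinf | 0 < W i j}.Finite)
    (hconn : (SimpleGraph.fromRel fun i j : Vinf => 0 < W i j).Connected)
    (Vn Vm : Finset Vinf) (hsub : Vn ⊆ Vm)
    (hconn_n : (SimpleGraph.fromRel
      fun i j : Option {i : Vinf // i ∈ Vn} => 0 < wiredW W Vn i j).Connected)
    (hconn_m : (SimpleGraph.fromRel
      fun i j : Option {i : Vinf // i ∈ Vm} => 0 < wiredW W Vm i j).Connected)
    (a b : Vinf → ℝ) (ha : ∀ i ∈ Vm, 0 < a i)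
    (hab : ∀ i ∈ Vm, i ∉ Vn → a i = 1 ∧ b i = 0) :
    (∫ p, Real.exp (-(∑ j : {j : Vinf // j ∈ Vn},
          (((a j.1) ^ 2 + (b j.1) ^ 2 - 1) * betaW (wiredW W Vn) p.1 (some j)
            + b j.1 * thetaW (wiredW W Vn) p.1 p.2 (some j))))
        ∂(muW (wiredW W Vn) none)
      = ∫ p, Real.exp (-(∑ j : {j : Vinf // j ∈ Vn},
          (((a j.1) ^ 2 + (b j.1) ^ 2 - 1)
              * betaW (wiredW W Vm) p.1 (some ⟨j.1, hsub j.2⟩)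
            + b j.1 * thetaW (wiredW W Vm) p.1 p.2 (some ⟨j.1, hsub j.2⟩))))
        ∂(muW (wiredW W Vm) none))
    ∧ Measure.map
        (fun p => ((fun j : {j : Vinf // j ∈ Vn} => betaW (wiredW W Vn) p.1 (some j)),
          (fun j : {j : Vinf // j ∈ Vn} => thetaW (wiredW W Vn) p.1 p.2 (some j))))
        (muW (wiredW W Vn) none)
      = Measure.map
        (fun p => ((fun j : {j : Vinf // j ∈ Vn} =>
            betaW (wiredW W Vm) p.1 (some ⟨j.1, hsub j.2⟩)),
          (fun j : {j : Vinf // j ∈ Vn} =>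
            thetaW (wiredW W Vm) p.1 p.2 (some ⟨j.1, hsub j.2⟩))))
        (muW (wiredW W Vm) none) := by
  have hmeas : ∀ (S T : Finset Vinf) (hST : S ⊆ T), Measurable
      (fun p : (Option {i // i ∈ T} → ℝ) × (Option {i // i ∈ T} → ℝ) =>
        ((fun j : {j : Vinf // j ∈ S} => betaW (wiredW W T) p.1 (some ⟨j.1, hST j.2⟩)),
          (fun j : {j : Vinf // j ∈ S} =>
            thetaW (wiredW W T) p.1 p.2 (some ⟨j.1, hST j.2⟩)))) := by
    intro S T hST
    have hb := kc_beta_meas (wiredW W T)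
    have ht := kc_theta_meas (wiredW W T)
    refine Measurable.prodMk ?_ ?_
    · exact measurable_pi_lambda _ fun i => (measurable_pi_apply _).comp hb
    · exact measurable_pi_lambda _ fun i => (measurable_pi_apply _).comp ht
  have hn := kc_law_S W hsymm hdiag hnonneg Vn hconn_n
  have hm := kc_law_S W hsymm hdiag hnonneg Vm hconn_m
  have hcons := kcNuS_cons W hsymm hnonneg hlocfin Vn Vm hsub
  rw [← hm, Measure.map_map (by fun_prop) (hmeas Vm Vm subset_rfl)] at hcons
  have hlaw := hn.trans hcons.symm
  refine ⟨?_, hlaw⟩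
  let G : ({j : Vinf // j ∈ Vn} → ℝ) × ({j : Vinf // j ∈ Vn} → ℝ) → ℝ := fun q =>
    Real.exp (-(∑ j : {j : Vinf // j ∈ Vn},
      (((a j.1) ^ 2 + (b j.1) ^ 2 - 1) * q.1 j + b j.1 * q.2 j)))
  have hG : Measurable G := by
    have : Continuous G := by
      show Continuous fun q : ({j : Vinf // j ∈ Vn} → ℝ) × ({j : Vinf // j ∈ Vn} → ℝ) =>
        Real.exp (-(∑ j : {j : Vinf // j ∈ Vn},
        (((a j.1) ^ 2 + (b j.1) ^ 2 - 1) * q.1 j + b j.1 * q.2 j)))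
      fun_prop
    exact this.measurable
  have e1 := integral_map (μ := muW (wiredW W Vn) none) (hmeas Vn Vn subset_rfl).aemeasurable
    hG.aestronglyMeasurable
  have e2 := integral_map (μ := muW (wiredW W Vm) none) (hmeas Vn Vm hsub).aemeasurable
    hG.aestronglyMeasurable
  refine e1.symm.trans (Eq.trans ?_ e2)
  exact congrArg (fun μ => ∫ q, G q ∂μ) hlaw
end
end
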